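/- arXiv:1209.3905 — 5 statements merged into one kernel-verified Lean document; each statement's English description precedes it below -/
import Mathlib

section
/- Let Ω ⊂ ℝ^d be a nonempty bounded open set and let E be a dyadic function on Ω that is positive and regular. Then for every H ∈ ℝ and every p ∈ ℝ, if the level set E_E^Ω(H) = {x ∈ Ω : h_E(x) = H} is nonempty, then dim_H(E_E^Ω(H)) ≤ H·p − τ_E^Ω(p); consequently the multifractal spectrum is bounded above by the Legendre spectrum: dim_H(E_E^Ω(H)) ≤ inf_{p∈ℝ}(H·p − τ_E^Ω(p)). -/
open MeasureTheory Filter Metric Set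
open scoped ENNReal Topology

noncomputable section

/-- The dyadic cube of scale `j` with index `k`:
`λ = ∏_i [k_i 2^{-j}, (k_i+1) 2^{-j})`. -/
def dyadicCube (d : ℕ) (j : ℕ) (k : Fin d → ℤ) : Set (Fin d → ℝ) :=
  {y | ∀ i, (k i : ℝ) * 2 ^ (-(j : ℤ)) ≤ y i ∧ y i < ((k i : ℝ) + 1) * 2 ^ (-(j : ℤ))}

/-- The index of the unique dyadic cube of scale `j` containing `x`. -/
def dyadicIndex (d : ℕ) (j : ℕ) (x : Fin d → ℝ) : Fin d → ℤ :=
  fun i => ⌊x i * 2 ^ (j : ℕ)⌋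

/-- The lower exponent of a dyadic function `e` at `x`:
`h_E(x) = liminf_{j→∞} log e_{λ_j(x)} / log 2^{-j}`, taken in `[-∞,∞]` with the
convention `log 0 = -∞` (so that the quotient by the negative quantity `log 2^{-j}`
is `+∞` when `e_{λ_j(x)} = 0`). -/
def lowerExp {d : ℕ} (e : ℕ → (Fin d → ℤ) → ℝ) (x : Fin d → ℝ) : EReal :=
  Filter.liminf
    (fun j : ℕ =>
      if e j (dyadicIndex d j x) = 0 then (⊤ : EReal)
      else ((Real.log (e j (dyadicIndex d j x)) / Real.log ((2 : ℝ) ^ (-(j : ℤ))) : ℝ) : EReal))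
    Filter.atTop

/-- The structure function `S_j(ω,p) = Σ_{λ ⊆ ω, ⟨λ⟩ = j} (e_λ)^p` of a dyadic
function `e` on `ω` (a finite sum when `ω` is bounded). -/
def structFn {d : ℕ} (e : ℕ → (Fin d → ℤ) → ℝ) (ω : Set (Fin d → ℝ)) (j : ℕ) (p : ℝ) : ℝ :=
  ∑ᶠ k ∈ {k : Fin d → ℤ | dyadicCube d j k ⊆ ω}, e j k ^ p

/-- The scaling function `τ_E^ω(p) = liminf_{j→∞} log S_j(ω,p) / log 2^{-j}`. -/
def scalingFn {d : ℕ} (e : ℕ → (Fin d → ℤ) → ℝ) (ω : Set (Fin d → ℝ)) (p : ℝ) : ℝ :=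
  Filter.liminf
    (fun j : ℕ => Real.log (structFn e ω j p) / Real.log ((2 : ℝ) ^ (-(j : ℤ))))
    Filter.atTop

/-- The local scaling function `τ_E(x,p) = lim_{r→0⁺} τ_E^{B(x,r)∩Ω}(p)`; since
`r ↦ τ_E^{B(x,r)∩Ω}(p)` is nonincreasing in `r`, the limit equals the supremum
over `r > 0`. -/
def locScalingFn {d : ℕ} (e : ℕ → (Fin d → ℤ) → ℝ) (Ω : Set (Fin d → ℝ))
    (x : Fin d → ℝ) (p : ℝ) : ℝ :=
  ⨆ r : {r : ℝ // 0 < r}, scalingFn e (Metric.ball x r.1 ∩ Ω) p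

/-- The local multifractal spectrum
`d_E(x,H) = lim_{r→0⁺} dim_H {y ∈ B(x,r) ∩ Ω : h_E(y) = H}`; since the spectrum on
`B(x,r) ∩ Ω` is nondecreasing in `r`, the limit equals the infimum over `r > 0`. -/
def locSpectrum {d : ℕ} (e : ℕ → (Fin d → ℤ) → ℝ) (Ω : Set (Fin d → ℝ))
    (x : Fin d → ℝ) (H : ℝ) : ℝ≥0∞ :=
  ⨅ (r : ℝ) (_ : 0 < r),
    dimH {y ∈ Metric.ball x r ∩ Ω | lowerExp e y = (H : EReal)}

/-- The dyadic function `e` is positive and regular on `Ω`: every `e_λ` with `λ ⊆ Ω`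
is positive, and `C₁ 2^{-Bj} ≤ e_λ ≤ C₂ 2^{-Aj}` for all dyadic `λ ⊆ Ω` of scale `j`. -/
def PositiveRegular {d : ℕ} (e : ℕ → (Fin d → ℤ) → ℝ) (Ω : Set (Fin d → ℝ)) : Prop :=
  (∀ j k, dyadicCube d j k ⊆ Ω → 0 < e j k) ∧
  ∃ C₁ C₂ A B : ℝ, 0 < C₁ ∧ 0 < C₂ ∧
    ∀ j k, dyadicCube d j k ⊆ Ω →
      C₁ * 2 ^ (-(B * j)) ≤ e j k ∧ e j k ≤ C₂ * 2 ^ (-(A * j))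

lemma log_two_zpow_neg (j : ℕ) :
    Real.log ((2 : ℝ) ^ (-(j : ℤ))) = -((j : ℝ) * Real.log 2) := by
  rw [Real.log_zpow]; push_cast; ring

lemma mem_dyadicCube_dyadicIndex {d : ℕ} (j : ℕ) (x : Fin d → ℝ) :
    x ∈ dyadicCube d j (dyadicIndex d j x) := by
  intro i
  have h2 : (0 : ℝ) < 2 ^ j := by positivity
  simp only [dyadicIndex, zpow_neg, zpow_natCast, ← div_eq_mul_inv]
  exact ⟨(div_le_iff₀ h2).2 (Int.floor_le _), (lt_div_iff₀ h2).2 (Int.lt_floor_add_one _)⟩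

lemma dist_le_of_mem_dyadicCube {d j : ℕ} {k : Fin d → ℤ} {x y : Fin d → ℝ}
    (hx : x ∈ dyadicCube d j k) (hy : y ∈ dyadicCube d j k) :
    dist x y ≤ (2 : ℝ) ^ (-(j : ℤ)) := by
  refine (dist_pi_le_iff (by positivity)).2 fun i => ?_
  rw [Real.dist_eq, abs_le]
  constructor <;> nlinarith [hx i, hy i]

lemma ediam_dyadicCube_le (d j : ℕ) (k : Fin d → ℤ) :
    ediam (dyadicCube d j k) ≤ ENNReal.ofReal ((2 : ℝ) ^ (-(j : ℝ))) := by
  refine ediam_le fun x hx y hy => ?_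
  rw [edist_dist]
  refine ENNReal.ofReal_le_ofReal ?_
  have := dist_le_of_mem_dyadicCube hx hy
  rwa [← Real.rpow_intCast, Int.cast_neg, Int.cast_natCast] at this

lemma eventually_dyadicCube_subset {d : ℕ} {Ω : Set (Fin d → ℝ)} (hΩ : IsOpen Ω)
    {x : Fin d → ℝ} (hx : x ∈ Ω) :
    ∀ᶠ j : ℕ in atTop, dyadicCube d j (dyadicIndex d j x) ⊆ Ω := by
  obtain ⟨r, hr, hball⟩ := Metric.isOpen_iff.1 hΩ x hx
  have ht : Tendsto (fun j : ℕ => ((2 : ℝ)⁻¹) ^ j) atTop (𝓝 0) :=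
    tendsto_pow_atTop_nhds_zero_of_lt_one (by norm_num) (by norm_num)
  filter_upwards [ht.eventually (gt_mem_nhds hr)] with j hj y hy
  refine hball (mem_ball.2 (lt_of_le_of_lt ?_ hj))
  have := dist_le_of_mem_dyadicCube hy (mem_dyadicCube_dyadicIndex j x)
  rwa [zpow_neg, zpow_natCast, ← inv_pow] at this

lemma exists_card_dyadicCube_le {d : ℕ} {Ω : Set (Fin d → ℝ)} (hΩ : Bornology.IsBounded Ω) :
    ∃ M : ℝ, 1 ≤ M ∧ ∀ j : ℕ, ∃ F : Finset (Fin d → ℤ),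
      (∀ k, k ∈ F ↔ dyadicCube d j k ⊆ Ω) ∧ (F.card : ℝ) ≤ M * 2 ^ ((d : ℝ) * j) := by
  classical
  obtain ⟨R₀, hR₀⟩ := hΩ.subset_closedBall 0
  obtain ⟨R, hR⟩ := exists_nat_gt (max R₀ 1)
  have hR1 : (1 : ℝ) < R := (le_max_right _ _).trans_lt hR
  refine ⟨(3 * R) ^ d, one_le_pow₀ (by linarith), fun j => ?_⟩
  let G : Finset (Fin d → ℤ) :=
    Fintype.piFinset fun _ => Finset.Icc (-((R : ℤ) * 2 ^ j)) ((R : ℤ) * 2 ^ j)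
  refine ⟨G.filter fun k => dyadicCube d j k ⊆ Ω, fun k => ?_, ?_⟩
  · rw [Finset.mem_filter, and_iff_right_iff_imp]
    intro hk
    have hmem : (fun i => (k i : ℝ) * 2 ^ (-(j : ℤ))) ∈ dyadicCube d j k := fun i =>
      ⟨le_rfl, mul_lt_mul_of_pos_right (lt_add_one _) (by positivity)⟩
    have hnorm := mem_closedBall_zero_iff.1 (hR₀ (hk hmem))
    simp only [G, Fintype.mem_piFinset, Finset.mem_Icc]
    intro i
    have hi := (norm_le_pi_norm _ i).trans hnorm
    rw [← abs_le, ← Int.cast_le (R := ℝ)]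
    have h2 : (0 : ℝ) < 2 ^ j := by positivity
    simp only [Real.norm_eq_abs, zpow_neg, zpow_natCast, ← div_eq_mul_inv] at hi
    rw [abs_div, abs_of_pos h2, div_le_iff₀ h2] at hi
    push_cast
    refine hi.trans ?_
    gcongr
    exact ((le_max_left _ _).trans_lt hR).le
  · have h2 : (1 : ℝ) ≤ 2 ^ j := one_le_pow₀ (by norm_num)
    calc ((G.filter fun k => dyadicCube d j k ⊆ Ω).card : ℝ) ≤ G.card := by
          exact_mod_cast Finset.card_filter_le _ _
      _ = (2 * R * 2 ^ j + 1) ^ d := by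
          have : ((R : ℤ) * 2 ^ j + 1 - -((R : ℤ) * 2 ^ j)).toNat = 2 * R * 2 ^ j + 1 := by
            have : (R : ℤ) * 2 ^ j + 1 - -((R : ℤ) * 2 ^ j) = ((2 * R * 2 ^ j + 1 : ℕ) : ℤ) := by
              push_cast; ring
            rw [this, Int.toNat_natCast]
          simp only [G, Fintype.card_piFinset_const, Int.card_Icc, this]
          push_cast
          rfl
      _ ≤ (3 * R * 2 ^ j) ^ d := by
          gcongr
          nlinarith
      _ = (3 * R) ^ d * 2 ^ ((d : ℝ) * j) := by
          rw [mul_pow, ← pow_mul, ← Real.rpow_natCast 2 (j * d)]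
          push_cast
          rw [mul_comm (j : ℝ)]

lemma structFn_eq_sum {d : ℕ} (e : ℕ → (Fin d → ℤ) → ℝ) {Ω : Set (Fin d → ℝ)} {j : ℕ}
    {F : Finset (Fin d → ℤ)} (hF : ∀ k, k ∈ F ↔ dyadicCube d j k ⊆ Ω) (p : ℝ) :
    structFn e Ω j p = ∑ k ∈ F, e j k ^ p := by
  have : {k : Fin d → ℤ | dyadicCube d j k ⊆ Ω} = (F : Set (Fin d → ℤ)) := by
    ext k; simp [hF]
  rw [structFn, this, finsum_mem_coe_finset]

lemma PositiveRegular.exists_rpow_le {d : ℕ} {e : ℕ → (Fin d → ℤ) → ℝ} {Ω : Set (Fin d → ℝ)}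
    (he : PositiveRegular e Ω) (p : ℝ) :
    ∃ C a : ℝ, 0 < C ∧ ∀ j k, dyadicCube d j k ⊆ Ω → e j k ^ p ≤ C * 2 ^ (a * j) := by
  obtain ⟨hpos, C₁, C₂, A, B, hC₁, hC₂, hb⟩ := he
  have key (C D : ℝ) (hC : 0 < C) (j : ℕ) :
      (C * 2 ^ (-(D * j))) ^ p = C ^ p * 2 ^ (-(D * p) * j) := by
    rw [Real.mul_rpow hC.le (by positivity), ← Real.rpow_mul (by norm_num)]
    ring_nf
  rcases le_total 0 p with hp | hp
  · refine ⟨C₂ ^ p, -(A * p), by positivity, fun j k hk => ?_⟩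
    rw [← key C₂ A hC₂]
    exact Real.rpow_le_rpow (hpos j k hk).le (hb j k hk).2 hp
  · refine ⟨C₁ ^ p, -(B * p), by positivity, fun j k hk => ?_⟩
    rw [← key C₁ B hC₁]
    exact Real.rpow_le_rpow_of_nonpos (by positivity) (hb j k hk).1 hp

lemma PositiveRegular.exists_structFn_le {d : ℕ} {e : ℕ → (Fin d → ℤ) → ℝ}
    {Ω : Set (Fin d → ℝ)} (he : PositiveRegular e Ω) (hΩ : Bornology.IsBounded Ω) (p : ℝ) :
    ∃ M a : ℝ, 1 ≤ M ∧ 0 ≤ a ∧ ∀ j, structFn e Ω j p ≤ M * 2 ^ (a * j) := by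
  obtain ⟨C, a, hC, hCa⟩ := he.exists_rpow_le p
  obtain ⟨M, hM, hF⟩ := exists_card_dyadicCube_le hΩ
  refine ⟨M * max C 1, d + max a 0, ?_, by positivity, fun j => ?_⟩
  · exact one_le_mul_of_one_le_of_one_le hM (le_max_right _ _)
  obtain ⟨F, hmem, hcard⟩ := hF j
  rw [structFn_eq_sum e hmem]
  calc ∑ k ∈ F, e j k ^ p ≤ ∑ k ∈ F, max C 1 * (2 : ℝ) ^ (max a 0 * j) := by
        refine Finset.sum_le_sum fun k hk => (hCa j k ((hmem k).1 hk)).trans ?_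
        gcongr
        · exact le_max_left _ _
        · norm_num
        · exact le_max_left _ _
    _ = F.card * (max C 1 * (2 : ℝ) ^ (max a 0 * j)) := by simp
    _ ≤ (M * 2 ^ ((d : ℝ) * j)) * (max C 1 * (2 : ℝ) ^ (max a 0 * j)) := by gcongr
    _ = M * max C 1 * 2 ^ ((d + max a 0) * j) := by
        rw [add_mul, Real.rpow_add (by norm_num)]; ring

lemma PositiveRegular.eventually_structFn_le {d : ℕ} {e : ℕ → (Fin d → ℤ) → ℝ}
    {Ω : Set (Fin d → ℝ)} (he : PositiveRegular e Ω) (hΩ : Bornology.IsBounded Ω) {p t : ℝ}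
    (ht : t < scalingFn e Ω p) :
    ∀ᶠ j : ℕ in atTop, structFn e Ω j p ≤ 2 ^ (-(t * j)) := by
  have hlog2 := Real.log_pos one_lt_two
  obtain ⟨M, a, hM, ha, hS⟩ := he.exists_structFn_le hΩ p
  have hnonneg (j : ℕ) : 0 ≤ structFn e Ω j p :=
    finsum_mem_induction (0 ≤ ·) le_rfl (fun _ _ => add_nonneg) fun k hk =>
      (Real.rpow_pos_of_pos (he.1 j k hk) p).le
  have hbdd : IsBoundedUnder (· ≥ ·) atTop (fun j : ℕ =>
      Real.log (structFn e Ω j p) / Real.log ((2 : ℝ) ^ (-(j : ℤ)))) := by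
    refine isBoundedUnder_of_eventually_ge (a := -(a + Real.log M / Real.log 2)) ?_
    filter_upwards [eventually_ge_atTop 1] with j hj
    have hj1 : (1 : ℝ) ≤ j := by exact_mod_cast hj
    have hjpos : 0 < (j : ℝ) * Real.log 2 := by positivity
    have hlogM : 0 ≤ Real.log M := Real.log_nonneg hM
    have hlog : Real.log (structFn e Ω j p) ≤ Real.log M + a * j * Real.log 2 := by
      rcases (hnonneg j).eq_or_lt with h0 | h0
      · rw [← h0, Real.log_zero]; positivity
      · refine (Real.log_le_log h0 (hS j)).trans_eq ?_
        rw [Real.log_mul (by positivity) (by positivity), Real.log_rpow (by norm_num)]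
    rw [log_two_zpow_neg, div_neg, neg_le_neg_iff, div_le_iff₀ hjpos]
    have h1 : Real.log M / Real.log 2 * (j * Real.log 2) = Real.log M * j := by
      field_simp
    rw [add_mul, h1]
    nlinarith
  filter_upwards [eventually_lt_of_lt_liminf ht hbdd, eventually_ge_atTop 1] with j hj hj1
  rcases (hnonneg j).eq_or_lt with h0 | h0
  · rw [← h0]; positivity
  have hjpos : 0 < (j : ℝ) * Real.log 2 := by
    have : (1 : ℝ) ≤ j := by exact_mod_cast hj1
    positivity
  rw [log_two_zpow_neg, div_neg, lt_neg, div_lt_iff₀ hjpos] at hj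
  rw [← Real.log_le_log_iff h0 (by positivity), Real.log_rpow (by norm_num)]
  linarith

lemma frequently_le_rpow_of_lowerExp_eq {d : ℕ} {e : ℕ → (Fin d → ℤ) → ℝ} {x : Fin d → ℝ}
    (hpos : ∀ᶠ j : ℕ in atTop, 0 < e j (dyadicIndex d j x)) {H : ℝ}
    (hx : lowerExp e x = (H : EReal)) (p : ℝ) {δ : ℝ} (hδ : 0 < δ) :
    ∃ᶠ j : ℕ in atTop, (2 : ℝ) ^ (-((H * p + δ) * j)) ≤ e j (dyadicIndex d j x) ^ p := by
  have hlog2 := Real.log_pos one_lt_two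
  set ε := δ / (|p| + 1) with hε
  have hε0 : 0 < ε := by positivity
  have hεp : |p| * ε ≤ δ := by
    rw [hε, mul_div_assoc', div_le_iff₀ (by positivity)]
    nlinarith [abs_nonneg p]
  have hgood : ∀ᶠ j : ℕ in atTop, 1 ≤ j ∧ 0 < e j (dyadicIndex d j x) :=
    (eventually_ge_atTop 1).and hpos
  suffices h : ∃ᶠ j : ℕ in atTop, 1 ≤ j ∧ 0 < e j (dyadicIndex d j x) ∧
      Real.log (e j (dyadicIndex d j x)) / -((j : ℝ) * Real.log 2) * p ≤ H * p + δ by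
    refine h.mono fun j ⟨hj, he, hle⟩ => ?_
    have hjpos : 0 < (j : ℝ) * Real.log 2 := by
      have : (1 : ℝ) ≤ j := by exact_mod_cast hj
      positivity
    rw [← Real.log_le_log_iff (by positivity) (by positivity), Real.log_rpow (by norm_num),
      Real.log_rpow he]
    rw [div_neg, neg_mul, div_mul_eq_mul_div, ← neg_div, div_le_iff₀ hjpos] at hle
    linarith
  rcases le_total 0 p with hp | hp
  · have hlt : lowerExp e x < ((H + ε : ℝ) : EReal) := by
      rw [hx]; exact_mod_cast lt_add_of_pos_right H hε0
    refine ((frequently_lt_of_liminf_lt (by isBoundedDefault) hlt).and_eventually hgood).mono ?_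
    rintro j ⟨hj, hj1, he⟩
    rw [if_neg he.ne', log_two_zpow_neg, EReal.coe_lt_coe_iff] at hj
    refine ⟨hj1, he, (mul_le_mul_of_nonneg_right hj.le hp).trans ?_⟩
    rw [abs_of_nonneg hp] at hεp
    linarith
  · have hlt : ((H - ε : ℝ) : EReal) < lowerExp e x := by
      rw [hx]; exact_mod_cast sub_lt_self H hε0
    refine Eventually.frequently ?_
    filter_upwards [eventually_lt_of_lt_liminf hlt, hgood] with j hj hj'
    rw [if_neg hj'.2.ne', log_two_zpow_neg, EReal.coe_lt_coe_iff] at hj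
    refine ⟨hj'.1, hj'.2, (mul_le_mul_of_nonpos_right hj.le hp).trans ?_⟩
    rw [abs_of_nonpos hp] at hεp
    linarith

lemma dimH_le_of_frequently_mem {d : ℕ} {A : Set (Fin d → ℝ)} {F : ℕ → Finset (Fin d → ℤ)}
    {s δ : ℝ} (hs : 0 < s) (hδ : 0 < δ)
    (hA : ∀ x ∈ A, ∃ᶠ j : ℕ in atTop, dyadicIndex d j x ∈ F j)
    (hF : ∀ᶠ j : ℕ in atTop, ((F j).card : ℝ) ≤ 2 ^ ((s - δ) * j)) :
    dimH A ≤ ENNReal.ofReal s := by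
  set q : ℝ := 2 ^ (-δ) with hq
  have hq0 : 0 < q := by positivity
  have hq1 : q < 1 := Real.rpow_lt_one_of_one_lt_of_neg one_lt_two (neg_neg_of_pos hδ)
  have hhalf : Tendsto (fun n : ℕ => ENNReal.ofReal ((2 : ℝ) ^ (-(n : ℝ)))) atTop (𝓝 0) := by
    rw [← ENNReal.ofReal_zero]
    refine ENNReal.tendsto_ofReal ?_
    have := tendsto_pow_atTop_nhds_zero_of_lt_one (r := (2 : ℝ)⁻¹) (by norm_num) (by norm_num)
    refine this.congr fun n => ?_
    rw [Real.rpow_neg (by norm_num), Real.rpow_natCast, inv_pow]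
  have hmeas := Measure.hausdorffMeasure_le_liminf_tsum (ι := fun n => Σ j : ℕ, F (j + n)) s A _
    hhalf (fun n i => dyadicCube d (i.1 + n) i.2.1)
    (Eventually.of_forall fun n i => (ediam_dyadicCube_le _ _ _).trans
      (ENNReal.ofReal_le_ofReal (Real.rpow_le_rpow_of_exponent_le one_le_two
        (by push_cast; linarith [(Nat.cast_nonneg i.1 : (0 : ℝ) ≤ i.1)]))))
    (Eventually.of_forall fun n x hx => by
      obtain ⟨j, hj, hmem⟩ := frequently_atTop.1 (hA x hx) n
      obtain ⟨m, rfl⟩ := Nat.exists_eq_add_of_le' hj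
      exact mem_iUnion.2 ⟨⟨m, ⟨_, hmem⟩⟩, mem_dyadicCube_dyadicIndex _ x⟩)
  have hsum : ∀ᶠ n : ℕ in atTop,
      ∑' i : (Σ j : ℕ, F (j + n)), ediam (dyadicCube d (i.1 + n) i.2.1) ^ s
        ≤ ∑' j : ℕ, ENNReal.ofReal q ^ j := by
    obtain ⟨N, hN⟩ := eventually_atTop.1 hF
    filter_upwards [eventually_ge_atTop N] with n hn
    rw [ENNReal.tsum_sigma']
    refine ENNReal.tsum_le_tsum fun j => ?_
    have hcard := hN (j + n) (by omega)
    calc ∑' k : F (j + n), ediam (dyadicCube d (j + n) k.1) ^ s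
        ≤ ∑' k : F (j + n), ENNReal.ofReal ((2 : ℝ) ^ (-(s * (j + n : ℕ)))) := by
          refine ENNReal.tsum_le_tsum fun k => ?_
          refine (ENNReal.rpow_le_rpow (ediam_dyadicCube_le _ _ _) hs.le).trans_eq ?_
          rw [ENNReal.ofReal_rpow_of_pos (by positivity), ← Real.rpow_mul (by norm_num)]
          ring_nf
      _ = ENNReal.ofReal ((F (j + n)).card * (2 : ℝ) ^ (-(s * (j + n : ℕ)))) := by
          rw [tsum_fintype, Finset.sum_const, nsmul_eq_mul, Finset.card_univ, Fintype.card_coe,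
            ENNReal.ofReal_mul (by positivity), ENNReal.ofReal_natCast]
      _ ≤ ENNReal.ofReal (q ^ j) := by
          refine ENNReal.ofReal_le_ofReal ?_
          calc ((F (j + n)).card : ℝ) * (2 : ℝ) ^ (-(s * (j + n : ℕ)))
              ≤ 2 ^ ((s - δ) * (j + n : ℕ)) * (2 : ℝ) ^ (-(s * (j + n : ℕ))) := by gcongr
            _ = q ^ (j + n) := by
              rw [← Real.rpow_add (by norm_num), hq, ← Real.rpow_natCast,
                ← Real.rpow_mul (by norm_num)]
              ring_nf
            _ ≤ q ^ j := pow_le_pow_of_le_one hq0.le hq1.le (by omega)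
      _ = ENNReal.ofReal q ^ j := ENNReal.ofReal_pow hq0.le j
  have hfin : ∑' j : ℕ, ENNReal.ofReal q ^ j ≠ ∞ := by
    rw [ENNReal.tsum_geometric, ENNReal.inv_ne_top, ne_eq, tsub_eq_zero_iff_le, not_le]
    exact ENNReal.ofReal_lt_one.2 hq1
  have htop : μH[(s.toNNReal : ℝ)] A ≠ ∞ := by
    rw [Real.coe_toNNReal s hs.le]
    refine ne_top_of_le_ne_top hfin (hmeas.trans ?_)
    exact liminf_le_of_frequently_le hsum.frequently
  exact dimH_le_of_hausdorffMeasure_ne_top htop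

/-- The scale-`j` cubes in `Ω` that matter for the level set of `H` number at most
`2 ^ ((s - δ) * j)`, for any `s` above `H * p - scalingFn e Ω p` and some `δ > 0`. -/
lemma PositiveRegular.exists_cover_level_set {d : ℕ} {e : ℕ → (Fin d → ℤ) → ℝ}
    {Ω : Set (Fin d → ℝ)} (he : PositiveRegular e Ω) (hΩo : IsOpen Ω)
    (hΩb : Bornology.IsBounded Ω) {H p s : ℝ} (hs : H * p - scalingFn e Ω p < s) :
    ∃ (F : ℕ → Finset (Fin d → ℤ)) (δ : ℝ), 0 < δ ∧
      (∀ x ∈ {x ∈ Ω | lowerExp e x = (H : EReal)},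
        ∃ᶠ j : ℕ in atTop, dyadicIndex d j x ∈ F j) ∧
      ∀ᶠ j : ℕ in atTop, ((F j).card : ℝ) ≤ 2 ^ ((s - δ) * j) := by
  classical
  obtain ⟨M, -, hF⟩ := exists_card_dyadicCube_le hΩb
  choose F hmem _ using hF
  set δ := (s - (H * p - scalingFn e Ω p)) / 3 with hδ
  have hδ0 : 0 < δ := by rw [hδ]; linarith
  refine ⟨fun j => (F j).filter fun k => (2 : ℝ) ^ (-((H * p + δ) * j)) ≤ e j k ^ p,
    δ, hδ0, ?_, ?_⟩
  · rintro x ⟨hxΩ, hx⟩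
    have hsub := eventually_dyadicCube_subset hΩo hxΩ
    refine ((frequently_le_rpow_of_lowerExp_eq (hsub.mono fun j hj => he.1 j _ hj) hx p
      hδ0).and_eventually hsub).mono fun j hj => ?_
    exact Finset.mem_filter.2 ⟨(hmem j _).2 hj.2, hj.1⟩
  · filter_upwards [he.eventually_structFn_le hΩb (sub_lt_self (scalingFn e Ω p) hδ0)] with j hj
    rw [structFn_eq_sum e (hmem j)] at hj
    set G := (F j).filter fun k => (2 : ℝ) ^ (-((H * p + δ) * j)) ≤ e j k ^ p with hG
    have h1 : (G.card : ℝ) * 2 ^ (-((H * p + δ) * j))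
        ≤ 2 ^ (-((scalingFn e Ω p - δ) * j)) := by
      refine le_trans ?_ hj
      rw [← nsmul_eq_mul]
      refine (Finset.card_nsmul_le_sum G _ _ fun k hk => (Finset.mem_filter.1 hk).2).trans ?_
      exact Finset.sum_le_sum_of_subset_of_nonneg (Finset.filter_subset _ _) fun k hk _ =>
        (Real.rpow_pos_of_pos (he.1 j k ((hmem j k).1 hk)) p).le
    rw [← le_div_iff₀ (by positivity), ← Real.rpow_sub (by norm_num)] at h1
    refine h1.trans_eq ?_
    congr 1
    rw [hδ]; ring

/-- Upper bound of the multifractal spectrum by the Legendre spectrum: if `Ω` is a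
nonempty bounded open set, `E` is a positive regular dyadic function on `Ω`, and the
level set `E_E^Ω(H)` is nonempty, then for every `p ∈ ℝ`,
`dim_H E_E^Ω(H) ≤ H p − τ_E^Ω(p)`, and consequently
`dim_H E_E^Ω(H) ≤ inf_{p∈ℝ} (H p − τ_E^Ω(p))`. -/
theorem spectrum_le_legendre {d : ℕ} (Ω : Set (Fin d → ℝ))
    (hΩo : IsOpen Ω) (hΩne : Ω.Nonempty) (hΩb : Bornology.IsBounded Ω)
    (e : ℕ → (Fin d → ℤ) → ℝ) (hreg : PositiveRegular e Ω) (H : ℝ)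
    (hne : {x ∈ Ω | lowerExp e x = (H : EReal)}.Nonempty) :
    (∀ p : ℝ,
        (dimH {x ∈ Ω | lowerExp e x = (H : EReal)} : EReal)
          ≤ ((H * p - scalingFn e Ω p : ℝ) : EReal)) ∧
      (dimH {x ∈ Ω | lowerExp e x = (H : EReal)} : EReal)
        ≤ ⨅ p : ℝ, ((H * p - scalingFn e Ω p : ℝ) : EReal) := by
  have main : ∀ p : ℝ, (dimH {x ∈ Ω | lowerExp e x = (H : EReal)} : EReal)
      ≤ ((H * p - scalingFn e Ω p : ℝ) : EReal) := by
    intro p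
    have hnonneg : ∀ s : ℝ, H * p - scalingFn e Ω p < s → 0 ≤ s := by
      intro s hs
      by_contra! hs0
      obtain ⟨F, δ, hδ, hA, hF⟩ := hreg.exists_cover_level_set hΩo hΩb hs
      obtain ⟨x, hx⟩ := hne
      obtain ⟨j, hjx, hj, hj1⟩ :=
        ((hA x hx).and_eventually (hF.and (eventually_ge_atTop 1))).exists
      have hcard : (1 : ℝ) ≤ (F j).card := by
        exact_mod_cast Finset.card_pos.2 ⟨_, hjx⟩
      have hjpos : (0 : ℝ) < j := by exact_mod_cast hj1
      have hlt : (2 : ℝ) ^ ((s - δ) * j) < 1 :=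
        Real.rpow_lt_one_of_one_lt_of_neg one_lt_two
          (mul_neg_of_neg_of_pos (by linarith) hjpos)
      linarith
    refine EReal.le_of_forall_lt_iff_le.1 fun s hs => ?_
    rw [EReal.coe_lt_coe_iff] at hs
    obtain ⟨r, hr, hrs⟩ := exists_between hs
    have hs0 : 0 < s := (hnonneg r hr).trans_lt hrs
    obtain ⟨F, δ, hδ, hA, hF⟩ := hreg.exists_cover_level_set hΩo hΩb hs
    have hdim := dimH_le_of_frequently_mem hs0 hδ hA hF
    rw [← EReal.coe_ennreal_le_coe_ennreal_iff, EReal.coe_ennreal_ofReal,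
      max_eq_left hs0.le] at hdim
    exact hdim
  exact ⟨main, le_iInf main⟩

end
end

section
/- Let Ω ⊂ ℝ^d be a nonempty open set and let E be a dyadic function on Ω. For every open set ω ⊂ Ω and every H ∈ ℝ, dim_H{x ∈ ω : h_E(x) = H} = sup_{x ∈ ω} d_E(x,H); that is, the local multifractal spectrum recovers the multifractal spectrum of E on every open subset. -/
open MeasureTheory Filter Metric Set
open scoped ENNReal Topology

noncomputable section

/-- The local multifractal spectrum recovers the multifractal spectrum on every open
subset: for a dyadic function `E` on a nonempty open set `Ω`, every open `ω ⊆ Ω`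
and every `H ∈ ℝ`, `dim_H {x ∈ ω : h_E(x) = H} = sup_{x ∈ ω} d_E(x,H)`. -/
theorem spectrum_eq_iSup_locSpectrum {d : ℕ} (Ω : Set (Fin d → ℝ))
    (hΩo : IsOpen Ω) (hΩne : Ω.Nonempty)
    (e : ℕ → (Fin d → ℤ) → ℝ)
    (hnn : ∀ j k, dyadicCube d j k ⊆ Ω → 0 ≤ e j k)
    (ω : Set (Fin d → ℝ)) (hωo : IsOpen ω) (hωΩ : ω ⊆ Ω) (H : ℝ) :
    dimH {x ∈ ω | lowerExp e x = (H : EReal)} = ⨆ x ∈ ω, locSpectrum e Ω x H := by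
  apply le_antisymm
  · refine le_of_forall_lt fun c hc => ?_
    obtain ⟨b, hcb, hb⟩ := exists_between hc
    obtain ⟨x, hx, hxt⟩ := exists_mem_nhdsWithin_lt_dimH_of_lt_dimH hb
    refine hcb.trans_le (le_trans ?_ (le_iSup₂ x hx.1))
    refine le_iInf₂ fun r hr => (hxt _ ?_).le
    filter_upwards [self_mem_nhdsWithin, mem_nhdsWithin_of_mem_nhds (ball_mem_nhds x hr)]
      with y hy hyr
    exact ⟨⟨hyr, hωΩ hy.1⟩, hy.2⟩
  · refine iSup₂_le fun x hx => ?_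
    obtain ⟨r, hr, hrω⟩ := Metric.isOpen_iff.1 hωo x hx
    exact (iInf₂_le r hr).trans (dimH_mono fun y hy => ⟨hrω hy.1.1, hy.2⟩)

end
end

section
/- Let x ∈ [0,1). If the frequency of zeros N_{0,n}(x)/n converges to some N₀ ∈ [0,1] as n → ∞, then (log m_n(x))/(log 2^{-n}) converges as n → ∞ and the dyadic lower exponent of the localized Bernoulli measure satisfies h^d(x) = lim_{n→∞} (log m_n(x))/(log 2^{-n}) = −N₀·log₂ p(x) − (1−N₀)·log₂(1−p(x)). -/
open MeasureTheory Filter Metric Set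
open scoped ENNReal Topology

noncomputable section

/-- The `i`-th binary digit of `x ∈ [0,1)` (for `i ≥ 1`):
`ε_i(x) = ⌊2^i x⌋ − 2⌊2^{i−1} x⌋`. -/
def binDigit (x : ℝ) (i : ℕ) : ℤ := ⌊x * 2 ^ i⌋ - 2 * ⌊x * 2 ^ (i - 1)⌋

/-- `k_i(x) = Σ_{l=1}^{i−1} ε_l(x) 2^{-l} + 2^{-i}`. -/
def kPoint (x : ℝ) (i : ℕ) : ℝ :=
  (∑ l ∈ Finset.Icc 1 (i - 1), (binDigit x l : ℝ) * 2 ^ (-(l : ℤ))) + 2 ^ (-(i : ℤ))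

/-- `w_i(x) = p(k_i(x))` if `ε_i(x) = 0`, and `w_i(x) = 1 − p(k_i(x))` otherwise. -/
def wFactor (p : ℝ → ℝ) (x : ℝ) (i : ℕ) : ℝ :=
  if binDigit x i = 0 then p (kPoint x i) else 1 - p (kPoint x i)

/-- `m_n(x) = ∏_{i=1}^n w_i(x)`: the mass given by the localized Bernoulli measure
associated with `p` to the dyadic interval of generation `n` containing `x`. -/
def bernMass (p : ℝ → ℝ) (x : ℝ) (n : ℕ) : ℝ :=
  ∏ i ∈ Finset.Icc 1 n, wFactor p x i

/-- The dyadic lower exponent `h^d(x) = liminf_{n→∞} log m_n(x) / log 2^{-n}`. -/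
def bernExp (p : ℝ → ℝ) (x : ℝ) : ℝ :=
  Filter.liminf
    (fun n : ℕ => Real.log (bernMass p x n) / Real.log ((2 : ℝ) ^ (-(n : ℤ))))
    Filter.atTop

/-- `N_{0,n}(x)`: the number of indices `1 ≤ i ≤ n` with `ε_i(x) = 0`. -/
def zeroCount (x : ℝ) (n : ℕ) : ℕ :=
  ((Finset.Icc 1 n).filter fun i => binDigit x i = 0).card

theorem sum_binDigit_eq_floor_div {x : ℝ} (hx : x ∈ Set.Ico (0 : ℝ) 1) (m : ℕ) :
    ∑ l ∈ Finset.Icc 1 m, (binDigit x l : ℝ) * 2 ^ (-(l : ℤ)) = ⌊x * 2 ^ m⌋ / 2 ^ m := by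
  induction m with
  | zero => simp [Int.floor_eq_zero_iff.mpr hx]
  | succ m ih =>
    rw [Finset.sum_Icc_succ_top (by omega), ih]
    simp only [binDigit, Nat.add_sub_cancel, zpow_neg, zpow_natCast]
    push_cast
    field_simp
    ring

theorem kPoint_succ {x : ℝ} (hx : x ∈ Set.Ico (0 : ℝ) 1) (m : ℕ) :
    kPoint x (m + 1) = (⌊x * 2 ^ m⌋ + 1 / 2) / 2 ^ m := by
  rw [kPoint, Nat.add_sub_cancel, sum_binDigit_eq_floor_div hx, zpow_neg, zpow_natCast]
  field_simp
  ring

theorem kPoint_succ_mem_Icc {x : ℝ} (hx : x ∈ Set.Ico (0 : ℝ) 1) (m : ℕ) :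
    kPoint x (m + 1) ∈ Set.Icc (0 : ℝ) 1 := by
  have h2 : (0 : ℝ) < 2 ^ m := by positivity
  have h0 : (0 : ℝ) ≤ ⌊x * 2 ^ m⌋ := by
    exact_mod_cast Int.floor_nonneg.mpr (mul_nonneg hx.1 h2.le)
  have h1 : ⌊x * 2 ^ m⌋ + 1 ≤ (2 : ℤ) ^ m := by
    rw [Int.add_one_le_iff, Int.floor_lt]
    push_cast
    nlinarith [hx.2]
  have h1' : (⌊x * 2 ^ m⌋ : ℝ) + 1 ≤ 2 ^ m := by exact_mod_cast h1
  rw [kPoint_succ hx]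
  exact ⟨by positivity, by rw [div_le_one h2]; linarith⟩

theorem abs_kPoint_succ_sub_le {x : ℝ} (hx : x ∈ Set.Ico (0 : ℝ) 1) (m : ℕ) :
    |kPoint x (m + 1) - x| ≤ (1 / 2 : ℝ) ^ m := by
  have h2 : (0 : ℝ) < 2 ^ m := by positivity
  have h : kPoint x (m + 1) - x = (⌊x * 2 ^ m⌋ + 1 / 2 - x * 2 ^ m) / 2 ^ m := by
    rw [kPoint_succ hx]
    field_simp
  rw [h, abs_div, abs_of_pos h2, one_div_pow]
  gcongr
  rw [abs_le]
  constructor <;> linarith [Int.floor_le (x * 2 ^ m), Int.lt_floor_add_one (x * 2 ^ m)]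

theorem tendsto_kPoint_succ {x : ℝ} (hx : x ∈ Set.Ico (0 : ℝ) 1) :
    Tendsto (fun m => kPoint x (m + 1)) atTop (𝓝[Set.Icc 0 1] x) := by
  refine tendsto_nhdsWithin_iff.mpr ⟨?_, .of_forall (kPoint_succ_mem_Icc hx)⟩
  rw [tendsto_iff_dist_tendsto_zero]
  exact squeeze_zero (fun _ => dist_nonneg) (abs_kPoint_succ_sub_le hx)
    (tendsto_pow_atTop_nhds_zero_of_lt_one (by norm_num) (by norm_num))

/-- Asymptotically, the factors `w_i(x)` may be replaced by `p x` or `1 - p x` according to the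
digits of `x`. -/
theorem tendsto_log_wFactor_sub {p : ℝ → ℝ} (hpc : ContinuousOn p (Set.Icc 0 1)) {x : ℝ}
    (hx : x ∈ Set.Ico (0 : ℝ) 1) (h0 : p x ≠ 0) (h1 : 1 - p x ≠ 0) :
    Tendsto (fun i => Real.log (wFactor p x (i + 1)) -
      if binDigit x (i + 1) = 0 then Real.log (p x) else Real.log (1 - p x))
      atTop (𝓝 0) := by
  have hp : Tendsto (fun i => p (kPoint x (i + 1))) atTop (𝓝 (p x)) :=
    (hpc x (Set.Ico_subset_Icc_self hx)).tendsto.comp (tendsto_kPoint_succ hx)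
  have hA : Tendsto (fun i => Real.log (p (kPoint x (i + 1))) - Real.log (p x)) atTop (𝓝 0) := by
    simpa using (hp.log h0).sub_const (Real.log (p x))
  have hB : Tendsto (fun i => Real.log (1 - p (kPoint x (i + 1))) - Real.log (1 - p x))
      atTop (𝓝 0) := by
    simpa using ((hp.const_sub 1).log h1).sub_const (Real.log (1 - p x))
  refine (hA.if' hB (p := fun i => binDigit x (i + 1) = 0)).congr fun i => ?_
  by_cases h : binDigit x (i + 1) = 0 <;> simp [wFactor, h]

theorem sum_ite_binDigit (x a b : ℝ) (n : ℕ) :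
    ∑ i ∈ Finset.range n, (if binDigit x (i + 1) = 0 then a else b) =
      zeroCount x n * a + (n - zeroCount x n) * b := by
  induction n with
  | zero => simp [zeroCount]
  | succ n ih =>
    have hz : (zeroCount x (n + 1) : ℝ) =
        zeroCount x n + if binDigit x (n + 1) = 0 then 1 else 0 := by
      simp only [zeroCount, Finset.card_filter]
      rw [Finset.sum_Icc_succ_top (by omega)]
      push_cast
      rfl
    rw [Finset.sum_range_succ, ih, hz]
    push_cast
    split_ifs <;> ring

theorem log_bernMass {p : ℝ → ℝ} {x : ℝ} (h : ∀ i, wFactor p x (i + 1) ≠ 0) (n : ℕ) :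
    Real.log (bernMass p x n) = ∑ i ∈ Finset.range n, Real.log (wFactor p x (i + 1)) := by
  rw [← Real.log_prod fun i _ => h i, bernMass, Finset.range_eq_Ico,
    Finset.prod_Ico_add' (wFactor p x) 0 n 1, zero_add, Finset.Ico_add_one_right_eq_Icc]

/-- If the frequency of zeros `N_{0,n}(x)/n` converges to `N₀ ∈ [0,1]`, then
`log m_n(x) / log 2^{-n}` converges and the dyadic lower exponent of the localized
Bernoulli measure satisfies
`h^d(x) = lim_n log m_n(x)/log 2^{-n} = −N₀ log₂ p(x) − (1−N₀) log₂ (1−p(x))`. -/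
theorem bernExp_of_digit_frequency (p : ℝ → ℝ)
    (hpc : ContinuousOn p (Set.Icc 0 1))
    (hpr : ∀ t ∈ Set.Icc (0 : ℝ) 1, p t ∈ Set.Ioo (0 : ℝ) (1 / 2))
    (x : ℝ) (hx : x ∈ Set.Ico (0 : ℝ) 1)
    (N₀ : ℝ) (hN₀ : N₀ ∈ Set.Icc (0 : ℝ) 1)
    (hfreq : Filter.Tendsto (fun n : ℕ => (zeroCount x n : ℝ) / n)
      Filter.atTop (nhds N₀)) :
    Filter.Tendsto
        (fun n : ℕ => Real.log (bernMass p x n) / Real.log ((2 : ℝ) ^ (-(n : ℤ))))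
        Filter.atTop
        (nhds (-N₀ * Real.logb 2 (p x) - (1 - N₀) * Real.logb 2 (1 - p x))) ∧
      bernExp p x = -N₀ * Real.logb 2 (p x) - (1 - N₀) * Real.logb 2 (1 - p x) := by
  have hpx := hpr x (Set.Ico_subset_Icc_self hx)
  have hw : ∀ i, wFactor p x (i + 1) ≠ 0 := fun i => by
    have hk := hpr _ (kPoint_succ_mem_Icc hx i)
    unfold wFactor
    split_ifs
    · exact hk.1.ne'
    · linarith [hk.2]
  have hlim : Filter.Tendsto
      (fun n : ℕ => Real.log (bernMass p x n) / Real.log ((2 : ℝ) ^ (-(n : ℤ))))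
      Filter.atTop
      (nhds (-N₀ * Real.logb 2 (p x) - (1 - N₀) * Real.logb 2 (1 - p x))) := by
    have hces := (tendsto_log_wFactor_sub hpc hx hpx.1.ne' (by linarith [hpx.2])).cesaro
    have hmain := (hces.add ((hfreq.mul_const (Real.log (p x))).add
      ((hfreq.const_sub 1).mul_const (Real.log (1 - p x))))).div_const (-Real.log 2)
    have hlog2 : Real.log 2 ≠ 0 := (Real.log_pos one_lt_two).ne'
    convert hmain.congr' ?_ using 2
    · simp only [Real.logb]
      field_simp
      ring
    · filter_upwards [eventually_gt_atTop 0] with n hn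
      have hn' : (n : ℝ) ≠ 0 := by exact_mod_cast hn.ne'
      rw [log_bernMass hw, Finset.sum_sub_distrib, sum_ite_binDigit, Real.log_zpow]
      push_cast
      field_simp
      ring
  exact ⟨hlim, hlim.liminf_eq⟩

end
end

section
/- Let x ∈ (0,1) and write q = p(x). (i) For every H ∈ [−log₂(1−q), −log₂ q], the local multifractal spectrum of the localized Bernoulli measure satisfies d(x,H) = −t·log₂ t − (1−t)·log₂(1−t) with t = (H + log₂(1−q))/(log₂(1−q) − log₂ q) (and the convention 0·log₂ 0 = 0); that is, it equals the multifractal spectrum of the standard Bernoulli measure with parameter q. (ii) For every H ≥ 0 with H > −log₂ q or H < −log₂(1−q), there exists r > 0 such that {y ∈ (x−r,x+r) ∩ (0,1) : h^d(y) = H} = ∅. -/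
open MeasureTheory Filter Metric Set
open scoped ENNReal Topology

noncomputable section

/-- The local multifractal spectrum of the localized Bernoulli measure at `x`:
`d(x,H) = lim_{r→0⁺} dim_H {y ∈ (x−r,x+r) ∩ (0,1) : h^d(y) = H}`; by monotonicity
in `r`, the limit equals the infimum over `r > 0`. -/
def bernLocSpectrum (p : ℝ → ℝ) (x : ℝ) (H : ℝ) : ℝ≥0∞ :=
  ⨅ (r : ℝ) (_ : 0 < r),
    dimH {y ∈ Set.Ioo (x - r) (x + r) ∩ Set.Ioo (0 : ℝ) 1 | bernExp p y = H}

/-! ### Binary digits -/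

lemma binDigit_succ_eq_zero_or_one (y : ℝ) (i : ℕ) :
    binDigit y (i + 1) = 0 ∨ binDigit y (i + 1) = 1 := by
  unfold binDigit
  have h1 := Int.floor_le (y * 2 ^ i)
  have h2 := Int.lt_floor_add_one (y * 2 ^ i)
  have h3 := Int.floor_le (y * 2 ^ (i + 1))
  have h4 := Int.lt_floor_add_one (y * 2 ^ (i + 1))
  simp only [Nat.add_sub_cancel]
  rw [pow_succ, ← mul_assoc] at *
  set A := ⌊y * 2 ^ i⌋
  set B := ⌊y * 2 ^ i * 2⌋
  have h5 : (2 * A : ℝ) < B + 1 := by linarith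
  have h6 : (B : ℝ) < 2 * A + 2 := by linarith
  have h5' : 2 * A < B + 1 := by exact_mod_cast h5
  have h6' : B < 2 * A + 2 := by exact_mod_cast h6
  omega

lemma sum_binDigit {y : ℝ} (hy : y ∈ Ico (0 : ℝ) 1) (n : ℕ) :
    ∑ l ∈ Finset.Icc 1 n, (binDigit y l : ℝ) * 2 ^ (-(l : ℤ)) = ⌊y * 2 ^ n⌋ / 2 ^ n := by
  induction n with
  | zero =>
    have : ⌊y⌋ = 0 := Int.floor_eq_zero_iff.2 hy
    simp [this]
  | succ n ih =>
    rw [Finset.sum_Icc_succ_top (by omega), ih, binDigit]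
    simp only [Nat.add_sub_cancel, zpow_neg, zpow_natCast]
    push_cast
    field_simp
    ring

lemma abs_sum_binDigit_sub_le {y : ℝ} (hy : y ∈ Ico (0 : ℝ) 1) (n : ℕ) :
    (∑ l ∈ Finset.Icc 1 n, (binDigit y l : ℝ) * 2 ^ (-(l : ℤ))) ≤ y ∧
    y < (∑ l ∈ Finset.Icc 1 n, (binDigit y l : ℝ) * 2 ^ (-(l : ℤ))) + (1 / 2) ^ n := by
  rw [sum_binDigit hy]
  have h1 := Int.floor_le (y * 2 ^ n)
  have h2 := Int.lt_floor_add_one (y * 2 ^ n)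
  have hp : (0 : ℝ) < 2 ^ n := by positivity
  constructor
  · rwa [div_le_iff₀ hp]
  · rw [one_div, inv_pow, ← one_div, ← add_div, lt_div_iff₀ hp]
    exact h2

lemma kPoint_bounds {y : ℝ} (hy : y ∈ Ico (0 : ℝ) 1) (n : ℕ) :
    kPoint y (n + 1) ∈ Icc (0 : ℝ) 1 ∧ |kPoint y (n + 1) - y| ≤ (1 / 2) ^ n := by
  have h := abs_sum_binDigit_sub_le hy n
  have hs := sum_binDigit hy n
  have hp : (0 : ℝ) < 2 ^ n := by positivity
  have h0 : (0 : ℤ) ≤ ⌊y * 2 ^ n⌋ := Int.floor_nonneg.2 (mul_nonneg hy.1 hp.le)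
  have h1 : ⌊y * 2 ^ n⌋ + 1 ≤ (2 ^ n : ℤ) := by
    rw [Int.add_one_le_iff, Int.floor_lt]
    push_cast
    nlinarith [hy.2]
  have h1' : (⌊y * 2 ^ n⌋ : ℝ) + 1 ≤ 2 ^ n := by exact_mod_cast h1
  have h0' : (0 : ℝ) ≤ ⌊y * 2 ^ n⌋ := by exact_mod_cast h0
  have hk : kPoint y (n + 1) = (∑ l ∈ Finset.Icc 1 n, (binDigit y l : ℝ) * 2 ^ (-(l : ℤ)))
      + (1 / 2) ^ n / 2 := by
    rw [kPoint, Nat.add_sub_cancel, zpow_neg, zpow_natCast, pow_succ, one_div, inv_pow]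
    congr 1
    field_simp
  have hq : (0 : ℝ) < (1 / 2) ^ n := by positivity
  refine ⟨⟨?_, ?_⟩, ?_⟩
  · rw [hk, hs]; positivity
  · rw [hk, hs, one_div, inv_pow]
    field_simp
    nlinarith
  · rw [hk, abs_le]; constructor <;> linarith [h.1, h.2]

lemma tendsto_kPoint {y : ℝ} (hy : y ∈ Ico (0 : ℝ) 1) :
    Tendsto (fun n => kPoint y (n + 1)) atTop (𝓝 y) := by
  rw [tendsto_iff_dist_tendsto_zero]
  refine squeeze_zero (fun _ => dist_nonneg) (fun n => ?_)
    (tendsto_pow_atTop_nhds_zero_of_lt_one (r := (1 / 2 : ℝ)) (by norm_num) (by norm_num))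
  rw [Real.dist_eq]
  exact (kPoint_bounds hy n).2

/-! ### The exponent in terms of the frequency of the digit `0` -/

lemma tendsto_logRatio_sub {p : ℝ → ℝ} (hpc : ContinuousOn p (Icc 0 1))
    (hpr : ∀ t ∈ Icc (0 : ℝ) 1, p t ∈ Ioo (0 : ℝ) (1 / 2)) {y : ℝ} (hy : y ∈ Ioo (0 : ℝ) 1) :
    Tendsto (fun n : ℕ => Real.log (bernMass p y n) / Real.log ((2 : ℝ) ^ (-(n : ℤ))) -
      (-Real.logb 2 (1 - p y) + (Real.logb 2 (1 - p y) - Real.logb 2 (p y)) *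
        (zeroCount y n / n))) atTop (𝓝 0) := by
  have hy' : y ∈ Ico (0 : ℝ) 1 := ⟨hy.1.le, hy.2⟩
  have hcont : ContinuousAt p y := hpc.continuousAt (Icc_mem_nhds hy.1 hy.2)
  have hpy := hpr y ⟨hy.1.le, hy.2.le⟩
  have ht : Tendsto (fun n => p (kPoint y (n + 1))) atTop (𝓝 (p y)) :=
    hcont.tendsto.comp (tendsto_kPoint hy')
  have hA : Tendsto (fun n => Real.logb 2 (p (kPoint y (n + 1))) - Real.logb 2 (p y))
      atTop (𝓝 0) := by
    have := (Real.continuousAt_logb (b := 2) hpy.1.ne').tendsto.comp ht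
    simpa using this.sub_const (Real.logb 2 (p y))
  have hB : Tendsto (fun n => Real.logb 2 (1 - p (kPoint y (n + 1))) - Real.logb 2 (1 - p y))
      atTop (𝓝 0) := by
    have := (Real.continuousAt_logb (b := 2) (x := 1 - p y)
      (by linarith [hpy.2])).tendsto.comp (ht.const_sub 1)
    simpa using this.sub_const (Real.logb 2 (1 - p y))
  set g : ℕ → ℝ := fun i => Real.logb 2 (wFactor p y (i + 1)) -
    (if binDigit y (i + 1) = 0 then Real.logb 2 (p y) else Real.logb 2 (1 - p y)) with hg
  have hgt : Tendsto g atTop (𝓝 0) := by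
    refine squeeze_zero_norm (a := fun n => ‖Real.logb 2 (p (kPoint y (n + 1))) -
      Real.logb 2 (p y)‖ + ‖Real.logb 2 (1 - p (kPoint y (n + 1))) - Real.logb 2 (1 - p y)‖)
      (fun n => ?_) (by simpa using hA.norm.add hB.norm)
    simp only [hg, wFactor]
    split_ifs
    · exact le_add_of_nonneg_right (norm_nonneg _)
    · exact le_add_of_nonneg_left (norm_nonneg _)
  have hc := hgt.cesaro.neg
  rw [neg_zero] at hc
  refine hc.congr' ?_
  filter_upwards [eventually_gt_atTop 0] with n hn
  have hn' : (n : ℝ) ≠ 0 := by positivity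
  have hlog2 : Real.log 2 ≠ 0 := (Real.log_pos one_lt_two).ne'
  have hpos : ∀ i, wFactor p y (i + 1) ≠ 0 := by
    intro i
    have := hpr _ (kPoint_bounds hy' i).1
    unfold wFactor
    split_ifs
    · exact this.1.ne'
    · linarith [this.2]
  have hIcc : ∀ f : ℕ → ℝ, ∑ i ∈ Finset.Icc 1 n, f i = ∑ i ∈ Finset.range n, f (i + 1) := by
    intro f
    clear * -
    induction n with
    | zero => simp
    | succ n ih => rw [Finset.sum_Icc_succ_top (by omega), ih, Finset.sum_range_succ]
  have hm : Real.log (bernMass p y n) =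
      (∑ i ∈ Finset.range n, Real.logb 2 (wFactor p y (i + 1))) * Real.log 2 := by
    rw [bernMass, Real.log_prod (fun i hi => ?_), hIcc, Finset.sum_mul]
    · exact Finset.sum_congr rfl fun i _ => by
        rw [Real.logb, div_mul_cancel₀ _ hlog2]
    · obtain ⟨j, rfl⟩ : ∃ j, i = j + 1 := ⟨i - 1, by have := Finset.mem_Icc.1 hi; omega⟩
      exact hpos j
  have hz : (zeroCount y n : ℝ) = ∑ i ∈ Finset.range n,
      if binDigit y (i + 1) = 0 then (1 : ℝ) else 0 := by
    rw [zeroCount, Finset.card_filter]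
    push_cast
    exact hIcc fun i => if binDigit y i = 0 then (1 : ℝ) else 0
  have hl : Real.log ((2 : ℝ) ^ (-(n : ℤ))) = -(n * Real.log 2) := by
    rw [Real.log_zpow]; push_cast; ring
  have hs : ∑ i ∈ Finset.range n, (if binDigit y (i + 1) = 0 then Real.logb 2 (p y)
      else Real.logb 2 (1 - p y)) = n * Real.logb 2 (1 - p y) -
      (Real.logb 2 (1 - p y) - Real.logb 2 (p y)) * zeroCount y n := by
    rw [hz, Finset.mul_sum]
    have : (n : ℝ) * Real.logb 2 (1 - p y) = ∑ i ∈ Finset.range n, Real.logb 2 (1 - p y) := by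
      simp
    rw [this, ← Finset.sum_sub_distrib]
    refine Finset.sum_congr rfl fun i _ => ?_
    split_ifs <;> ring
  simp only [hg, Finset.sum_sub_distrib, hs, hm, hl]
  field_simp
  ring
/-! ### Upper bound for the dimension -/

/-- The number of indices `1 ≤ i ≤ n` with `ε_i(y) = e`. -/
def digitCount (e : ℤ) (y : ℝ) (n : ℕ) : ℕ :=
  (Finset.univ.filter fun i : Fin n => binDigit y (i + 1) = e).card

/-- The words of length `n` in which `true` occurs at most `s * n` times. -/
def sparseWords (s : ℝ) (n : ℕ) : Finset (Fin n → Bool) :=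
  Finset.univ.filter fun w => ((Finset.univ.filter fun i => w i = true).card : ℝ) ≤ s * n

/-- The dyadic interval on which the occurrences of the digit `e` are prescribed by `w`. -/
def wordInterval (e : ℤ) {n : ℕ} (w : Fin n → Bool) : Set ℝ :=
  {y ∈ Ico (0 : ℝ) 1 | ∀ i : Fin n, (binDigit y (i + 1) = e ↔ w i = true)}

lemma card_sparseWords_le {s : ℝ} (hs0 : 0 < s) (hs : s ≤ 1 / 2) (n : ℕ) :
    ((sparseWords s n).card : ℝ) ≤ Real.exp (Real.binEntropy s) ^ n := by
  have h1s : 0 < 1 - s := by linarith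
  have hone : ∑ w : Fin n → Bool, ∏ i, (if w i = true then s else 1 - s) = 1 := by
    have := Finset.prod_univ_sum (fun _ : Fin n => (Finset.univ : Finset Bool))
      (fun _ b => if b = true then s else 1 - s)
    rw [Fintype.piFinset_univ] at this
    rw [← this]
    simp
  have hw : ∀ w ∈ sparseWords s n, (Real.exp (Real.binEntropy s) ^ n)⁻¹ ≤
      ∏ i, (if w i = true then s else 1 - s) := by
    intro w hw
    set c := (Finset.univ.filter fun i => w i = true).card with hc
    have hcs : (c : ℝ) ≤ s * n := (Finset.mem_filter.1 hw).2
    have hcn : (Finset.univ.filter fun i => ¬ w i = true).card = (n : ℝ) - c := by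
      have := Finset.card_filter_add_card_filter_not (s := (Finset.univ : Finset (Fin n)))
        (fun i => w i = true)
      rw [Finset.card_univ, Fintype.card_fin] at this
      rw [eq_sub_iff_add_eq']
      exact_mod_cast this
    have hexp : ∀ k : ℕ, s ^ c * (1 - s) ^ k = Real.exp (c * Real.log s + k * Real.log (1 - s)) := by
      intro k
      rw [Real.exp_add, Real.exp_nat_mul, Real.exp_nat_mul, Real.exp_log hs0, Real.exp_log h1s]
    rw [Finset.prod_ite, Finset.prod_const, Finset.prod_const, ← hc,
      ← Real.exp_nat_mul, ← Real.exp_neg, hexp, Real.exp_le_exp, hcn,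
      Real.binEntropy_eq_negMulLog_add_negMulLog_one_sub, Real.negMulLog, Real.negMulLog]
    have hlog : Real.log s ≤ Real.log (1 - s) := Real.log_le_log hs0 (by linarith)
    nlinarith
  have hle : ((sparseWords s n).card : ℝ) * (Real.exp (Real.binEntropy s) ^ n)⁻¹ ≤ 1 := by
    rw [← hone, ← nsmul_eq_mul, ← Finset.sum_const]
    refine (Finset.sum_le_sum hw).trans
      (Finset.sum_le_sum_of_subset_of_nonneg (Finset.subset_univ _) fun w _ _ => ?_)
    exact Finset.prod_nonneg fun i _ => by split_ifs <;> linarith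
  rwa [mul_inv_le_iff₀ (by positivity), one_mul] at hle

lemma ediam_wordInterval_le {e : ℤ} (he : e = 0 ∨ e = 1) {n : ℕ} (w : Fin n → Bool) :
    ediam (wordInterval e w) ≤ ENNReal.ofReal ((1 / 2) ^ n) := by
  refine ediam_le fun y hy z hz => ?_
  rw [edist_dist, Real.dist_eq]
  refine ENNReal.ofReal_le_ofReal ?_
  have hyz : ∑ l ∈ Finset.Icc 1 n, (binDigit y l : ℝ) * 2 ^ (-(l : ℤ)) =
      ∑ l ∈ Finset.Icc 1 n, (binDigit z l : ℝ) * 2 ^ (-(l : ℤ)) := by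
    refine Finset.sum_congr rfl fun l hl => ?_
    obtain ⟨j, rfl⟩ : ∃ j, l = j + 1 := ⟨l - 1, by have := Finset.mem_Icc.1 hl; omega⟩
    have hj : j < n := by have := Finset.mem_Icc.1 hl; omega
    have h1 := (hy.2 ⟨j, hj⟩).trans (hz.2 ⟨j, hj⟩).symm
    simp only at h1
    have : binDigit y (j + 1) = binDigit z (j + 1) := by
      rcases binDigit_succ_eq_zero_or_one y j with h | h <;>
      rcases binDigit_succ_eq_zero_or_one z j with h' | h' <;>
      rcases he with he | he <;> simp_all
    rw [this]
  have h1 := abs_sum_binDigit_sub_le hy.1 n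
  have h2 := abs_sum_binDigit_sub_le hz.1 n
  rw [abs_le]
  constructor <;> linarith [h1.1, h1.2, h2.1, h2.2]

lemma dimH_frequently_digitCount_le {e : ℤ} (he : e = 0 ∨ e = 1) {s : ℝ} (hs0 : 0 < s)
    (hs : s ≤ 1 / 2) {d : NNReal} (hd : Real.binEntropy s < d * Real.log 2) :
    dimH {y ∈ Ico (0 : ℝ) 1 | ∃ᶠ n in atTop, (digitCount e y n : ℝ) ≤ s * n} ≤ d := by
  set S := {y ∈ Ico (0 : ℝ) 1 | ∃ᶠ n in atTop, (digitCount e y n : ℝ) ≤ s * n}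
  set ρ : ℝ := Real.exp (Real.binEntropy s) * (1 / 2 : ℝ) ^ (d : ℝ) with hρ
  have hρ0 : 0 < ρ := by positivity
  have hρ1 : ρ < 1 := by
    rw [hρ, Real.rpow_def_of_pos (by norm_num), ← Real.exp_add, Real.exp_lt_one_iff, one_div,
      Real.log_inv]
    linarith
  have hcover := Measure.hausdorffMeasure_le_liminf_tsum (ι := fun N : ℕ =>
      Σ m : ℕ, sparseWords s (N + m)) (d : ℝ) S (l := atTop)
    (fun N => ENNReal.ofReal ((1 / 2) ^ N)) ?_ (fun N i => wordInterval e i.2.1) ?_ ?_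
  · have hbound : ∀ N : ℕ, (∑' i : (Σ m : ℕ, sparseWords s (N + m)),
        ediam (wordInterval e i.2.1) ^ (d : ℝ)) ≤ ENNReal.ofReal (ρ ^ N * (1 - ρ)⁻¹) := by
      intro N
      rw [ENNReal.tsum_sigma']
      have hm : ∀ m : ℕ, (∑' w : sparseWords s (N + m), ediam (wordInterval e w.1) ^ (d : ℝ)) ≤
          ENNReal.ofReal (ρ ^ N * ρ ^ m) := by
        intro m
        have hw : ∀ w : sparseWords s (N + m), ediam (wordInterval e w.1) ^ (d : ℝ) ≤
            ENNReal.ofReal (((1 / 2 : ℝ) ^ (d : ℝ)) ^ (N + m)) := by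
          intro w
          refine (ENNReal.rpow_le_rpow (ediam_wordInterval_le he w.1) d.2).trans ?_
          rw [ENNReal.ofReal_rpow_of_nonneg (by positivity) d.2, ← Real.rpow_natCast,
            ← Real.rpow_natCast, ← Real.rpow_mul (by norm_num), ← Real.rpow_mul (by norm_num),
            mul_comm]
          exact le_rfl
        refine (ENNReal.tsum_le_tsum hw).trans ?_
        rw [tsum_fintype, Finset.sum_const, Finset.card_univ, Fintype.card_coe, nsmul_eq_mul,
          ← ENNReal.ofReal_natCast, ← ENNReal.ofReal_mul (by positivity), ← pow_add]
        refine ENNReal.ofReal_le_ofReal ?_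
        rw [hρ, mul_pow]
        gcongr
        exact card_sparseWords_le hs0 hs _
      refine (ENNReal.tsum_le_tsum hm).trans ?_
      rw [← ENNReal.ofReal_tsum_of_nonneg (fun _ => by positivity)
        ((summable_geometric_of_lt_one hρ0.le hρ1).mul_left _), tsum_mul_left,
        tsum_geometric_of_lt_one hρ0.le hρ1]
    have hlim : Tendsto (fun N : ℕ => ENNReal.ofReal (ρ ^ N * (1 - ρ)⁻¹)) atTop (𝓝 0) := by
      have := (tendsto_pow_atTop_nhds_zero_of_lt_one hρ0.le hρ1).mul_const (1 - ρ)⁻¹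
      simpa using ENNReal.tendsto_ofReal this
    have hz : μH[(d : ℝ)] S = 0 := by
      refine le_antisymm (hcover.trans ?_) zero_le
      refine (liminf_le_liminf (Eventually.of_forall hbound)).trans ?_
      rw [hlim.liminf_eq]
    exact dimH_le_of_hausdorffMeasure_ne_top (by rw [hz]; exact ENNReal.zero_ne_top)
  · have := tendsto_pow_atTop_nhds_zero_of_lt_one (r := (1 / 2 : ℝ)) (by norm_num) (by norm_num)
    simpa using ENNReal.tendsto_ofReal this
  · refine Eventually.of_forall fun N i => (ediam_wordInterval_le he i.2.1).trans ?_
    refine ENNReal.ofReal_le_ofReal ?_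
    exact pow_le_pow_of_le_one (by norm_num) (by norm_num) (Nat.le_add_right _ _)
  · refine Eventually.of_forall fun N y hy => ?_
    obtain ⟨n, hn, hc⟩ := (frequently_atTop.1 hy.2) N
    obtain ⟨m, rfl⟩ := Nat.exists_eq_add_of_le hn
    refine mem_iUnion.2 ⟨⟨m, ⟨fun i => decide (binDigit y (i + 1) = e), ?_⟩⟩, hy.1, fun i => ?_⟩
    · simp only [sparseWords, Finset.mem_filter, Finset.mem_univ, true_and, decide_eq_true_eq]
      exact hc
    · simp
/-! ### Binomial coefficients and entropy -/

lemma one_le_mul_choose_mul_pow {t : ℝ} (ht0 : 0 < t) (ht1 : t < 1) {L k : ℕ}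
    (hk : (k : ℝ) ≤ (L + 1) * t) (hk' : (L + 1) * t < k + 1) :
    1 ≤ ((L : ℝ) + 1) * (L.choose k * t ^ k * (1 - t) ^ (L - k)) := by
  have h1t : 0 < 1 - t := by linarith
  set f : ℕ → ℝ := fun j => L.choose j * t ^ j * (1 - t) ^ (L - j) with hf
  have hf0 : ∀ j, 0 ≤ f j := fun j => by positivity
  have hstep : ∀ j < L, f (j + 1) * ((j + 1) * (1 - t)) = f j * ((L - j) * t) := by
    intro j hj
    have h1 : (L.choose (j + 1) : ℝ) * (j + 1) = L.choose j * (L - j) := by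
      have := Nat.choose_succ_right_eq L j
      rw [← Nat.cast_sub hj.le]
      exact_mod_cast this
    have h2 : L - j = (L - (j + 1)) + 1 := by omega
    simp only [hf]
    rw [h2, pow_succ, pow_succ]
    linear_combination t ^ j * t * (1 - t) ^ (L - (j + 1)) * (1 - t) * h1
  have hup : ∀ j < L, j + 1 ≤ k → f j ≤ f (j + 1) := by
    intro j hj hjk
    have hjk' : (j : ℝ) + 1 ≤ k := by exact_mod_cast hjk
    have hpos : (0 : ℝ) < (j + 1) * (1 - t) := by positivity
    refine le_of_mul_le_mul_right ?_ hpos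
    rw [hstep j hj]
    refine mul_le_mul_of_nonneg_left ?_ (hf0 j)
    nlinarith
  have hdown : ∀ j < L, k ≤ j → f (j + 1) ≤ f j := by
    intro j hj hjk
    have hjk' : (k : ℝ) ≤ j := by exact_mod_cast hjk
    have hpos : (0 : ℝ) < (j + 1) * (1 - t) := by positivity
    refine le_of_mul_le_mul_right ?_ hpos
    rw [hstep j hj]
    refine mul_le_mul_of_nonneg_left ?_ (hf0 j)
    nlinarith
  have hkL : k ≤ L := by
    have : (k : ℝ) < L + 1 := by nlinarith
    exact Nat.lt_succ_iff.1 (by exact_mod_cast this)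
  have hmax : ∀ j ≤ L, f j ≤ f k := by
    intro j hj
    rcases le_total j k with h | h
    · induction h using Nat.decreasingInduction with
      | self => exact le_rfl
      | of_succ i hi ih => exact (hup i (by omega) hi).trans (ih (by omega))
    · induction j, h using Nat.le_induction with
      | base => exact le_rfl
      | succ i hi ih => exact (hdown i (by omega) hi).trans (ih (by omega))
  have hsum : ∑ j ∈ Finset.range (L + 1), f j = 1 := by
    have := add_pow t (1 - t) L
    rw [add_sub_cancel, one_pow] at this
    rw [this]
    exact Finset.sum_congr rfl fun j _ => by simp only [hf]; ring
  refine hsum.ge.trans ?_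
  refine (Finset.sum_le_sum fun j hj => hmax j (Nat.lt_succ_iff.1 (Finset.mem_range.1 hj))).trans ?_
  rw [Finset.sum_const, Finset.card_range, nsmul_eq_mul]
  push_cast
  rfl

lemma exists_block_parameters {t : ℝ} (ht0 : 0 < t) (ht1 : t < 1) {D : ℝ}
    (hD : D * Real.log 2 < Real.binEntropy t) :
    ∃ L k M : ℕ, (k : ℝ) < (L + M + 1 : ℕ) * t ∧ ((L + M + 1 : ℕ) : ℝ) * t < k + M ∧
      0 < L.choose k ∧ D * Real.log 2 * (L + M + 1 : ℕ) ≤ Real.log (L.choose k) := by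
  have h1t : 0 < 1 - t := by linarith
  obtain ⟨M, hM⟩ := exists_nat_gt (1 / (1 - t))
  rw [div_lt_iff₀ h1t] at hM
  have hM0 : (0 : ℝ) < M := by
    by_contra h
    nlinarith
  set c := (Real.binEntropy t - D * Real.log 2) / 2 with hc
  have hc0 : 0 < c := by rw [hc]; linarith
  set K := (1 - t) * -Real.log t + t * -Real.log (1 - t) with hK
  have hev : ∀ᶠ L : ℕ in atTop, Real.log ((L : ℝ) + 1) ≤ c * (L + 1) := by
    have h1 : Tendsto (fun L : ℕ => (L : ℝ) + 1) atTop atTop :=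
      tendsto_atTop_add_const_right _ _ tendsto_natCast_atTop_atTop
    filter_upwards [h1.eventually (Real.isLittleO_log_id_atTop.def hc0)] with L hL
    refine (le_abs_self _).trans (hL.trans_eq ?_)
    rw [id, Real.norm_of_nonneg (by positivity)]
  have hev2 : ∀ᶠ L : ℕ in atTop, (c + K + D * Real.log 2 * (M + 1)) / c ≤ L :=
    tendsto_natCast_atTop_atTop.eventually_ge_atTop _
  obtain ⟨L, hL1, hL2⟩ := (hev.and hev2).exists
  rw [div_le_iff₀ hc0] at hL2
  set k := ⌊((L : ℝ) + 1) * t⌋₊ with hk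
  have hkle : (k : ℝ) ≤ (L + 1) * t := Nat.floor_le (by positivity)
  have hklt : (L + 1) * t < (k : ℝ) + 1 := Nat.lt_floor_add_one _
  have hkL : k ≤ L := by
    have : (k : ℝ) < L + 1 := by nlinarith
    exact Nat.lt_succ_iff.1 (by exact_mod_cast this)
  have hch : 0 < L.choose k := Nat.choose_pos hkL
  refine ⟨L, k, M, ?_, ?_, hch, ?_⟩
  · push_cast; nlinarith
  · push_cast; nlinarith
  · have hone := one_le_mul_choose_mul_pow ht0 ht1 hkle hklt
    have hch' : (0 : ℝ) < L.choose k := by exact_mod_cast hch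
    have hlog := Real.log_le_log one_pos hone
    rw [Real.log_one, Real.log_mul (by positivity) (by positivity),
      Real.log_mul (by positivity) (by positivity), Real.log_mul (by positivity) (by positivity),
      Real.log_pow, Real.log_pow, Nat.cast_sub hkL] at hlog
    have hl0 : 0 < -Real.log t := by linarith [Real.log_neg ht0 ht1]
    have hl1 : 0 < -Real.log (1 - t) := by linarith [Real.log_neg h1t (by linarith)]
    have hent : Real.binEntropy t = t * -Real.log t + (1 - t) * -Real.log (1 - t) := by
      rw [Real.binEntropy_eq_negMulLog_add_negMulLog_one_sub, Real.negMulLog, Real.negMulLog]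
      ring
    have e1 : ((L + 1) * t - 1) * -Real.log t ≤ k * -Real.log t :=
      mul_le_mul_of_nonneg_right (by linarith) hl0.le
    have e2 : (L - (L + 1) * t) * -Real.log (1 - t) ≤ (L - k) * -Real.log (1 - t) :=
      mul_le_mul_of_nonneg_right (by linarith) hl1.le
    have e3 : L * Real.binEntropy t - K ≤ k * -Real.log t + (L - k) * -Real.log (1 - t) := by
      rw [hent, hK]; linarith
    have e4 : Real.binEntropy t = D * Real.log 2 + 2 * c := by rw [hc]; ring
    rw [e4] at e3
    push_cast
    nlinarith
/-! ### Binary expansions -/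

lemma exists_digits (F : ℕ → ℝ → ℝ → Fin 2) :
    ∃ d : ℕ → Fin 2, ∀ n, d n = F n (∑ i ∈ Finset.range n, Real.ofDigitsTerm d i)
      (∑ i ∈ Finset.range n, (1 - ((d i : ℕ) : ℝ))) := by
  let st : ℕ → ℝ × ℝ := fun n => Nat.rec (0, 0) (fun n s =>
    (s.1 + ((F n s.1 s.2 : ℕ) : ℝ) * (((2 : ℕ) : ℝ) ^ (n + 1))⁻¹,
      s.2 + (1 - ((F n s.1 s.2 : ℕ) : ℝ)))) n
  let d : ℕ → Fin 2 := fun n => F n (st n).1 (st n).2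
  have h : ∀ n, (st n).1 = ∑ i ∈ Finset.range n, Real.ofDigitsTerm d i ∧
      (st n).2 = ∑ i ∈ Finset.range n, (1 - ((d i : ℕ) : ℝ)) := by
    intro n
    induction n with
    | zero => simp [st]
    | succ n ih =>
      rw [Finset.sum_range_succ, Finset.sum_range_succ, ← ih.1, ← ih.2]
      exact ⟨rfl, rfl⟩
  exact ⟨d, fun n => by rw [← (h n).1, ← (h n).2]⟩

lemma ofDigits_eq_half (e : ℕ → Fin 2) :
    Real.ofDigits e = ((e 0 : ℕ) + Real.ofDigits fun i => e (i + 1)) / 2 := by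
  rw [Real.ofDigits_eq_sum_add_ofDigits e 1]
  simp only [Finset.sum_range_one, Real.ofDigitsTerm]
  norm_num
  ring

lemma ofDigits_lt_one {e : ℕ → Fin 2} {m : ℕ} (h : e m = 0) : Real.ofDigits e < 1 := by
  induction m generalizing e with
  | zero =>
    have := Real.ofDigits_le_one fun i => e (i + 1)
    rw [ofDigits_eq_half, h]
    simp only [Fin.val_zero, Nat.cast_zero]
    linarith
  | succ m ih =>
    have h1 := ih (e := fun i => e (i + 1)) h
    have h2 : ((e 0 : ℕ) : ℝ) ≤ 1 := by exact_mod_cast Nat.lt_succ_iff.1 (e 0).2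
    rw [ofDigits_eq_half]
    linarith

lemma inv_two_pow_le_ofDigits {e : ℕ → Fin 2} {m : ℕ} (h : e m = 1) :
    ((2 : ℝ) ^ (m + 1))⁻¹ ≤ Real.ofDigits e := by
  have := Real.summable_ofDigitsTerm (digits := e) |>.le_tsum m
    (fun _ _ => Real.ofDigitsTerm_nonneg)
  simpa [Real.ofDigits, Real.ofDigitsTerm, h] using this

lemma binDigit_ofDigits {d : ℕ → Fin 2} (hd : ∀ N, ∃ n ≥ N, d n = 0) (n : ℕ) :
    binDigit (Real.ofDigits d) (n + 1) = (d n : ℕ) := by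
  have hv : ∀ n, ⌊Real.ofDigits fun i => d (i + n)⌋ = 0 := by
    intro n
    obtain ⟨m, hm, h⟩ := hd n
    refine Int.floor_eq_zero_iff.2 ⟨Real.ofDigits_nonneg _, ofDigits_lt_one (m := m - n) ?_⟩
    rwa [Nat.sub_add_cancel hm]
  have hrec : ∀ n, (Real.ofDigits fun i => d (i + n)) * 2 =
      (d n : ℕ) + Real.ofDigits fun i => d (i + (n + 1)) := by
    intro n
    rw [ofDigits_eq_half, div_mul_cancel₀ _ two_ne_zero]
    simp only [zero_add, add_assoc, add_comm 1 n]
  have hA : ∀ n, ∃ A : ℤ, Real.ofDigits d * 2 ^ n = A + Real.ofDigits fun i => d (i + n) := by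
    intro n
    induction n with
    | zero => exact ⟨0, by simp⟩
    | succ n ih =>
      obtain ⟨A, hA⟩ := ih
      refine ⟨2 * A + (d n : ℕ), ?_⟩
      rw [pow_succ, ← mul_assoc, hA, add_mul, hrec]
      push_cast
      ring
  obtain ⟨A, hA⟩ := hA n
  have hA' : Real.ofDigits d * 2 ^ (n + 1) =
      (2 * A + (d n : ℕ) : ℤ) + Real.ofDigits fun i => d (i + (n + 1)) := by
    rw [pow_succ, ← mul_assoc, hA, add_mul, hrec]
    push_cast
    ring
  rw [binDigit, Nat.add_sub_cancel, hA, hA', Int.floor_intCast_add, Int.floor_intCast_add, hv, hv]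
  ring

lemma zeroCount_ofDigits {d : ℕ → Fin 2} (hd : ∀ N, ∃ n ≥ N, d n = 0) (n : ℕ) :
    (zeroCount (Real.ofDigits d) n : ℝ) = ∑ i ∈ Finset.range n, (1 - ((d i : ℕ) : ℝ)) := by
  rw [zeroCount, Finset.card_filter]
  induction n with
  | zero => simp
  | succ n ih =>
    rw [Finset.sum_Icc_succ_top (by omega), Finset.sum_range_succ, ← ih, Nat.cast_add,
      binDigit_ofDigits hd]
    congr 1
    have : ∀ c : Fin 2, (((if (((c : ℕ) : ℤ)) = 0 then 1 else 0 : ℕ)) : ℝ) = 1 - ((c : ℕ) : ℝ) := by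
      intro c
      fin_cases c <;> simp
    exact this (d n)

lemma inv_two_pow_le_abs_ofDigits_sub {d d' : ℕ → Fin 2} {i N : ℕ} (hi : i < N) (hne : d i ≠ d' i)
    (h : d N = 1) (h' : d' N = 1) :
    ((2 : ℝ) ^ (N + 1))⁻¹ ≤ |Real.ofDigits d - Real.ofDigits d'| := by
  classical
  have hex : ∃ i, d i ≠ d' i := ⟨i, hne⟩
  obtain ⟨j, hjN, hj, hlt⟩ : ∃ j, j < N ∧ d j ≠ d' j ∧ ∀ l < j, d l = d' l :=
    ⟨Nat.find hex, (Nat.find_min' hex hne).trans_lt hi, Nat.find_spec hex,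
      fun l hl => by simpa using Nat.find_min hex hl⟩
  clear hex hne hi i
  wlog h01 : d j = 1 ∧ d' j = 0 generalizing d d'
  · rw [abs_sub_comm]
    refine this h' h hj.symm (fun l hl => (hlt l hl).symm) ?_
    generalize d j = u at *
    generalize d' j = v at *
    revert hj h01
    clear * -
    revert u v
    decide
  have hs : ∑ l ∈ Finset.range j, Real.ofDigitsTerm d l =
      ∑ l ∈ Finset.range j, Real.ofDigitsTerm d' l :=
    Finset.sum_congr rfl fun l hl => by
      simp [Real.ofDigitsTerm, hlt l (Finset.mem_range.1 hl)]
  have hm : (fun l => d (l + (j + 1))) (N - (j + 1)) = 1 := by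
    simp only
    rwa [Nat.sub_add_cancel hjN]
  have h1 := inv_two_pow_le_ofDigits (e := fun l => d (l + (j + 1))) hm
  have h2 := Real.ofDigits_le_one fun l => d' (l + (j + 1))
  have hpow : ((2 : ℝ) ^ (N + 1))⁻¹ = ((2 : ℝ) ^ (j + 1))⁻¹ * ((2 : ℝ) ^ (N - (j + 1) + 1))⁻¹ := by
    rw [← mul_inv, ← pow_add]
    congr 2
    omega
  have hp : (0 : ℝ) < ((2 : ℝ) ^ (j + 1))⁻¹ := by positivity
  refine le_trans ?_ (le_abs_self _)
  rw [Real.ofDigits_eq_sum_add_ofDigits d (j + 1), Real.ofDigits_eq_sum_add_ofDigits d' (j + 1),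
    Finset.sum_range_succ, Finset.sum_range_succ, hs, hpow]
  simp only [Real.ofDigitsTerm, h01.1, h01.2, Fin.val_zero, Fin.val_one, Nat.cast_zero,
    Nat.cast_one, Nat.cast_ofNat]
  nlinarith

/-! ### Prescribing the frequency of zeros -/

lemma bddAbove_of_block_drift {G : ℕ → ℝ} {P j₀ : ℕ} {c : ℝ} (hP : 0 < P)
    (hstep : ∀ n, |G (n + 1) - G n| ≤ c)
    (hblock : ∀ j ≥ j₀, (∀ m < P, 0 ≤ G (j * P + m)) → G ((j + 1) * P) ≤ G (j * P)) :
    ∃ K, ∀ n ≥ j₀ * P, G n ≤ K := by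
  have hc0 : 0 ≤ c := (abs_nonneg _).trans (hstep 0)
  have hlip : ∀ n m : ℕ, |G (n + m) - G n| ≤ c * m := by
    intro n m
    induction m with
    | zero => simp
    | succ m ih =>
      have := abs_add_le (G (n + m + 1) - G (n + m)) (G (n + m) - G n)
      rw [sub_add_sub_cancel] at this
      push_cast
      rw [← add_assoc]
      linarith [hstep (n + m)]
  have hlip' : ∀ n : ℕ, ∀ m ≤ P, |G (n + m) - G n| ≤ c * P := fun n m hm =>
    (hlip n m).trans (mul_le_mul_of_nonneg_left (by exact_mod_cast hm) hc0)
  set K := max (G (j₀ * P)) (2 * (c * P)) with hK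
  have hj : ∀ j ≥ j₀, G (j * P) ≤ K := by
    intro j hj
    induction j, hj using Nat.le_induction with
    | base => exact le_max_left _ _
    | succ j hj ih =>
      by_cases hc : c * P ≤ G (j * P)
      · refine (hblock j hj fun m hm => ?_).trans ih
        linarith [(abs_le.1 (hlip' (j * P) m hm.le)).1]
      · have h1 := (abs_le.1 (hlip' (j * P) P le_rfl)).2
        rw [add_mul, one_mul]
        exact le_trans (by linarith) (le_max_right _ _)
  refine ⟨K + c * P, fun n hn => ?_⟩
  have h1 := (abs_le.1 (hlip' (n / P * P) (n % P) (Nat.mod_lt n hP).le)).2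
  rw [Nat.div_add_mod'] at h1
  linarith [hj (n / P) ((Nat.le_div_iff_mul_le hP).2 hn)]

lemma tendsto_frequency_of_greedy {T : ℝ → ℝ} {d : ℕ → Fin 2} {L k M j₀ : ℕ}
    (hT : ContinuousAt T (Real.ofDigits d))
    (hlow : (k : ℝ) < (L + M + 1 : ℕ) * T (Real.ofDigits d))
    (hupp : ((L + M + 1 : ℕ) : ℝ) * T (Real.ofDigits d) < k + M)
    (hfree : ∀ j ≥ j₀, ∑ r ∈ Finset.range L, (1 - ((d (j * (L + M + 1) + r) : ℕ) : ℝ)) = k)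
    (hone : ∀ j ≥ j₀, d (j * (L + M + 1) + (L + M)) = 1)
    (hgreedy : ∀ j ≥ j₀, ∀ r < M, d (j * (L + M + 1) + (L + r)) =
      if ((j * (L + M + 1) + (L + r) : ℕ) : ℝ) *
          T (∑ i ∈ Finset.range (j * (L + M + 1) + (L + r)), Real.ofDigitsTerm d i) ≤
          ∑ i ∈ Finset.range (j * (L + M + 1) + (L + r)), (1 - ((d i : ℕ) : ℝ))
        then 1 else 0) :
    Tendsto (fun n : ℕ => (∑ i ∈ Finset.range n, (1 - ((d i : ℕ) : ℝ))) / n) atTop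
      (𝓝 (T (Real.ofDigits d))) := by
  set P := L + M + 1 with hP
  have hP0 : 0 < P := by omega
  have hPpos : (0 : ℝ) < P := by exact_mod_cast hP0
  set τ := T (Real.ofDigits d) with hτ
  set Z : ℕ → ℝ := fun n => ∑ i ∈ Finset.range n, (1 - ((d i : ℕ) : ℝ)) with hZ
  have hZstep : ∀ n, Z (n + 1) = Z n + (1 - ((d n : ℕ) : ℝ)) := fun n => Finset.sum_range_succ _ _
  have hd01 : ∀ n, (0 : ℝ) ≤ ((d n : ℕ) : ℝ) ∧ ((d n : ℕ) : ℝ) ≤ 1 := fun n =>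
    ⟨by positivity, by exact_mod_cast Nat.lt_succ_iff.1 (d n).2⟩
  have hZblock : ∀ j ≥ j₀, Z ((j + 1) * P) = Z (j * P) + k +
      ∑ r ∈ Finset.range M, (1 - ((d (j * P + (L + r)) : ℕ) : ℝ)) := by
    intro j hj
    have : (j + 1) * P = j * P + (L + M + 1) := by rw [hP]; ring
    simp only [hZ]
    rw [this, Finset.sum_range_add, Finset.sum_range_succ, Finset.sum_range_add, hfree j hj,
      hone j hj]
    simp only [Fin.val_one, Nat.cast_one]
    ring
  have hS : Tendsto (fun n => T (∑ i ∈ Finset.range n, Real.ofDigitsTerm d i)) atTop (𝓝 τ) :=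
    hT.tendsto.comp Real.summable_ofDigitsTerm.hasSum.tendsto_sum_nat
  have hlarge : ∀ K : ℝ, ∀ ε > 0, ∀ᶠ n : ℕ in atTop, K < ε * n := fun K ε hε =>
    (tendsto_natCast_atTop_atTop.const_mul_atTop hε).eventually_gt_atTop K
  have hstep : ∀ n, |1 - ((d n : ℕ) : ℝ)| ≤ 1 := fun n => by
    rw [abs_le]; constructor <;> linarith [hd01 n]
  have hub : ∀ ε > 0, ∀ᶠ n : ℕ in atTop, Z n / n < τ + ε := by
    intro ε hε
    obtain ⟨j₁, hj₁⟩ := eventually_atTop.1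
      (hS.eventually (gt_mem_nhds (show τ < τ + ε / 2 by linarith)))
    obtain ⟨K, hK⟩ := bddAbove_of_block_drift (G := fun n => Z n - n * (τ + ε / 2)) (P := P)
      (j₀ := max j₀ j₁) (c := 1 + |τ + ε / 2|) hP0 (fun n => by
        rw [hZstep]
        have : Z n + (1 - ((d n : ℕ) : ℝ)) - ((n + 1 : ℕ) : ℝ) * (τ + ε / 2) -
          (Z n - n * (τ + ε / 2)) = (1 - ((d n : ℕ) : ℝ)) - (τ + ε / 2) := by push_cast; ring
        rw [this]
        exact (abs_sub _ _).trans (by linarith [hstep n])) (fun j hj hpos => by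
        have hjj₀ : j ≥ j₀ := (le_max_left _ _).trans hj
        have hsum : ∑ r ∈ Finset.range M, (1 - ((d (j * P + (L + r)) : ℕ) : ℝ)) = 0 := by
          refine Finset.sum_eq_zero fun r hr => ?_
          have hr' := Finset.mem_range.1 hr
          have h1 := hpos (L + r) (by omega)
          have h2 := hj₁ (j * P + (L + r)) (by
            have : j ≤ j * P := Nat.le_mul_of_pos_right _ hP0
            have := (le_max_right j₀ j₁).trans hj
            omega)
          rw [hgreedy j hjj₀ r hr', if_pos]
          · simp
          · refine le_trans ?_ (sub_nonneg.1 h1)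
            exact mul_le_mul_of_nonneg_left h2.le (by positivity)
        rw [hZblock j hjj₀, hsum]
        push_cast
        nlinarith)
    filter_upwards [hlarge K (ε / 2) (by linarith), eventually_ge_atTop (max j₀ j₁ * P),
      eventually_gt_atTop 0] with n h1 h2 h3
    have hn : (0 : ℝ) < n := by exact_mod_cast h3
    rw [div_lt_iff₀ hn]
    have := hK n h2
    linarith
  have hlb : ∀ ε > 0, ∀ᶠ n : ℕ in atTop, τ - ε < Z n / n := by
    intro ε hε
    obtain ⟨j₁, hj₁⟩ := eventually_atTop.1
      (hS.eventually (lt_mem_nhds (show τ - ε / 2 < τ by linarith)))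
    obtain ⟨K, hK⟩ := bddAbove_of_block_drift (G := fun n => n * (τ - ε / 2) - Z n) (P := P)
      (j₀ := max j₀ (j₁ + 1)) (c := 1 + |τ - ε / 2|) hP0 (fun n => by
        rw [hZstep]
        have : ((n + 1 : ℕ) : ℝ) * (τ - ε / 2) - (Z n + (1 - ((d n : ℕ) : ℝ))) -
          (n * (τ - ε / 2) - Z n) = (τ - ε / 2) - (1 - ((d n : ℕ) : ℝ)) := by push_cast; ring
        rw [this]
        exact (abs_sub _ _).trans (by linarith [hstep n])) (fun j hj hpos => by
        have hjj₀ : j ≥ j₀ := (le_max_left _ _).trans hj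
        have hsum : ∑ r ∈ Finset.range M, (1 - ((d (j * P + (L + r)) : ℕ) : ℝ)) = M := by
          rw [Finset.sum_congr rfl (g := fun _ => (1 : ℝ)), Finset.sum_const, Finset.card_range,
            nsmul_eq_mul, mul_one]
          intro r hr
          have hr' := Finset.mem_range.1 hr
          have h1 := hpos (L + r) (by omega)
          have hge : j₁ + 1 ≤ j * P + (L + r) := by
            have : j ≤ j * P := Nat.le_mul_of_pos_right _ hP0
            have := (le_max_right j₀ (j₁ + 1)).trans hj
            omega
          have h2 := hj₁ (j * P + (L + r)) (by omega)
          rw [hgreedy j hjj₀ r hr', if_neg]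
          · simp
          · refine not_le.2 ((sub_nonneg.1 h1).trans_lt ?_)
            exact mul_lt_mul_of_pos_left h2 (by exact_mod_cast (show 0 < _ by omega))
        rw [hZblock j hjj₀, hsum]
        push_cast
        nlinarith)
    filter_upwards [hlarge K (ε / 2) (by linarith), eventually_ge_atTop (max j₀ (j₁ + 1) * P),
      eventually_gt_atTop 0] with n h1 h2 h3
    have hn : (0 : ℝ) < n := by exact_mod_cast h3
    rw [lt_div_iff₀ hn]
    have := hK n h2
    linarith
  rw [Metric.tendsto_nhds]
  intro ε hε
  filter_upwards [hub ε hε, hlb ε hε] with n h1 h2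
  rw [Real.dist_eq, abs_lt]
  constructor <;> linarith

/-! ### Lower bound for the dimension -/

lemma le_dimH_range_of_separated {b : ℕ} (hb : 1 < b) {g : (ℕ → Fin b) → ℝ} {D C : NNReal}
    (hD : 0 < D)
    (h : ∀ a a' : ℕ → Fin b, ∀ j, (∀ i < j, a i = a' i) → a j ≠ a' j →
      ((b : ℝ) ^ j)⁻¹ ≤ C * |g a - g a'| ^ (D : ℝ)) :
    (D : ℝ≥0∞) ≤ dimH (range g) := by
  classical
  have key : ∀ a a' : ℕ → Fin b,
      |Real.ofDigits a - Real.ofDigits a'| ≤ C * |g a - g a'| ^ (D : ℝ) := by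
    intro a a'
    by_cases haa : a = a'
    · subst haa
      simp [hD.ne']
    · have hex : ∃ i, a i ≠ a' i := Function.ne_iff.1 haa
      have hlt : ∀ i < Nat.find hex, a i = a' i := fun i hi => by simpa using Nat.find_min hex hi
      refine le_trans ?_ (h a a' (Nat.find hex) hlt (Nat.find_spec hex))
      simpa using Real.abs_ofDigits_sub_ofDigits_le hlt
  have hinj : ∀ a a' : ℕ → Fin b, g a = g a' → Real.ofDigits a = Real.ofDigits a' := by
    intro a a' hg
    have := key a a'
    rw [hg, sub_self, abs_zero, Real.zero_rpow (by exact_mod_cast hD.ne'), mul_zero] at this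
    exact sub_eq_zero.1 (abs_nonpos_iff.1 this)
  have : NeZero b := ⟨by omega⟩
  set f : ℝ → ℝ := fun y => Real.ofDigits (Function.invFun g y)
  have hf : ∀ a, f (g a) = Real.ofDigits a := fun a =>
    hinj _ _ (Function.invFun_eq ⟨a, rfl⟩)
  have hhol : HolderOnWith C D f (range g) := by
    rintro _ ⟨a, rfl⟩ _ ⟨a', rfl⟩
    rw [hf, hf, edist_dist, edist_dist, Real.dist_eq, Real.dist_eq,
      ENNReal.ofReal_rpow_of_nonneg (abs_nonneg _) D.coe_nonneg, ← ENNReal.ofReal_coe_nnreal,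
      ← ENNReal.ofReal_mul C.coe_nonneg]
    exact ENNReal.ofReal_le_ofReal (key a a')
  have h1 : (1 : ℝ≥0∞) ≤ dimH (f '' range g) := by
    have hI : dimH (Icc (0 : ℝ) 1) = 1 := by
      rw [Real.dimH_of_nonempty_interior (by rw [interior_Icc]; exact nonempty_Ioo.2 one_pos)]
      simp
    rw [← hI]
    refine dimH_mono fun y hy => ?_
    obtain ⟨a, -, rfl⟩ := Real.ofDigits_SurjOn hb hy
    exact ⟨g a, mem_range_self a, hf a⟩
  have h2 := h1.trans (hhol.dimH_image_le hD)
  rwa [ENNReal.le_div_iff_mul_le (by simp [hD.ne']) (by simp), one_mul] at h2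

lemma le_dimH_frequency {T : ℝ → ℝ} (hT : ∀ y ∈ Ioo (0 : ℝ) 1, ContinuousAt T y) {x : ℝ}
    (hx : x ∈ Ioo (0 : ℝ) 1) (hTx : T x ∈ Ioo (0 : ℝ) 1) {D : NNReal} (hD : 0 < D)
    (hDT : D * Real.log 2 < Real.binEntropy (T x)) {r : ℝ} (hr : 0 < r) :
    (D : ℝ≥0∞) ≤ dimH {y ∈ Ioo (x - r) (x + r) ∩ Ioo 0 1 |
      Tendsto (fun n : ℕ => (zeroCount y n : ℝ) / n) atTop (𝓝 (T y))} := by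
  obtain ⟨L, k, M, hk, hkM, hpos, hlog⟩ := exists_block_parameters hTx.1 hTx.2 hDT
  set P := L + M + 1 with hP
  have hP0 : 0 < P := by omega
  have hPpos : (0 : ℝ) < P := by exact_mod_cast hP0
  set b := L.choose k with hb
  have hDpos : (0 : ℝ) < D := by exact_mod_cast hD
  have hlog2 : 0 < Real.log 2 := Real.log_pos one_lt_two
  have hb1 : 1 < b := by
    have : 0 < Real.log b := lt_of_lt_of_le (by positivity) hlog
    exact_mod_cast (Real.log_pos_iff (by positivity)).1 this
  have hk0 : 0 < k := by
    rcases Nat.eq_zero_or_pos k with h | h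
    · rw [hb, h, Nat.choose_zero_right] at hb1
      omega
    · exact h
  -- a neighbourhood of `x` on which the block parameters remain admissible
  obtain ⟨r₀, hr₀, hball⟩ : ∃ r₀ > 0, ∀ y, |y - x| < r₀ → y ∈ Ioo (x - r) (x + r) ∩ Ioo 0 1 ∧
      (k : ℝ) < P * T y ∧ P * T y < k + M := by
    have h1 : ∀ᶠ y in 𝓝 x, y ∈ Ioo (x - r) (x + r) ∩ Ioo 0 1 ∧
        (k : ℝ) < P * T y ∧ P * T y < k + M := by
      have hc : ContinuousAt (fun y => P * T y) x := continuousAt_const.mul (hT x hx)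
      refine Filter.Eventually.and (inter_mem (Ioo_mem_nhds (by linarith) (by linarith))
        (Ioo_mem_nhds hx.1 hx.2))
        ((hc.eventually (lt_mem_nhds hk)).and (hc.eventually (gt_mem_nhds hkM)))
    obtain ⟨r₀, hr₀, h⟩ := Metric.eventually_nhds_iff.1 h1
    exact ⟨r₀, hr₀, fun y hy => h (by rwa [Real.dist_eq])⟩
  obtain ⟨m₀, hm₀⟩ := exists_pow_lt_of_lt_one hr₀ (show ((2 : ℝ)⁻¹) < 1 by norm_num)
  -- admissible words
  have hcard : (Finset.powersetCard k (Finset.range L)).card = b := by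
    rw [Finset.card_powersetCard, Finset.card_range]
  let W : Fin b → Finset ℕ := fun c => ((Finset.equivFinOfCardEq hcard).symm c).1
  have hWmem : ∀ c, W c ⊆ Finset.range L ∧ (W c).card = k := fun c =>
    Finset.mem_powersetCard.1 ((Finset.equivFinOfCardEq hcard).symm c).2
  have hWinj : Function.Injective W := fun c c' h =>
    (Finset.equivFinOfCardEq hcard).symm.injective (Subtype.ext h)
  let F : (ℕ → Fin b) → ℕ → ℝ → ℝ → Fin 2 := fun a n S Z =>
    if n < m₀ * P then Real.digits x 2 n else
    if n % P < L then (if n % P ∈ W (a (n / P - m₀)) then 0 else 1) else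
    if n % P = L + M then 1 else if n * T S ≤ Z then 1 else 0
  choose d hd using fun a => exists_digits (F a)
  have hinit : ∀ a, ∀ n < m₀ * P, d a n = Real.digits x 2 n := fun a n hn => by
    rw [hd]; simp only [F, if_pos hn]
  have hge : ∀ j ≥ m₀, ∀ s, ¬ j * P + s < m₀ * P := fun j hj s => by
    have := Nat.mul_le_mul_right P hj
    omega
  have hmod : ∀ j, ∀ s < P, (j * P + s) % P = s := fun j s hs => by
    rw [add_comm, Nat.add_mul_mod_self_right, Nat.mod_eq_of_lt hs]
  have hdiv : ∀ j, ∀ s < P, (j * P + s) / P = j := fun j s hs => by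
    rw [add_comm, Nat.add_mul_div_right _ _ hP0, Nat.div_eq_of_lt hs, zero_add]
  have hfree : ∀ a, ∀ j ≥ m₀, ∀ s < L,
      d a (j * P + s) = if s ∈ W (a (j - m₀)) then 0 else 1 := fun a j hj s hs => by
    rw [hd]
    simp only [F, if_neg (hge j hj s), hmod j s (by omega), hdiv j s (by omega), if_pos hs]
  have hone : ∀ a, ∀ j ≥ m₀, d a (j * P + (L + M)) = 1 := fun a j hj => by
    rw [hd]
    simp only [F, if_neg (hge j hj _), hmod j (L + M) (by omega)]
    simp
  have hgreedy : ∀ a, ∀ j ≥ m₀, ∀ s < M, d a (j * P + (L + s)) =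
      if ((j * P + (L + s) : ℕ) : ℝ) *
          T (∑ i ∈ Finset.range (j * P + (L + s)), Real.ofDigitsTerm (d a) i) ≤
          ∑ i ∈ Finset.range (j * P + (L + s)), (1 - ((d a i : ℕ) : ℝ)) then 1 else 0 :=
      fun a j hj s hs => by
    rw [hd]
    simp only [F, if_neg (hge j hj _), hmod j (L + s) (by omega)]
    rw [if_neg (by omega), if_neg (by omega)]
  have hzeros : ∀ a N, ∃ n ≥ N, d a n = 0 := by
    intro a N
    obtain ⟨s, hs⟩ := Finset.card_pos.1 (hk0.trans_eq (hWmem (a (N + m₀ - m₀))).2.symm)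
    refine ⟨(N + m₀) * P + s, ?_, ?_⟩
    · have := Nat.le_mul_of_pos_right (N + m₀) hP0
      omega
    · rw [hfree a _ (by omega) s (Finset.mem_range.1 ((hWmem _).1 hs)), if_pos hs]
  have hclose : ∀ a, |Real.ofDigits (d a) - x| < r₀ := by
    intro a
    have h1 := Real.abs_ofDigits_sub_ofDigits_le (hinit a)
    rw [Real.ofDigits_digits one_lt_two ⟨hx.1.le, hx.2⟩] at h1
    refine (h1.trans ?_).trans_lt hm₀
    rw [Nat.cast_ofNat, ← inv_pow]
    exact pow_le_pow_of_le_one (by norm_num) (by norm_num) (Nat.le_mul_of_pos_right _ hP0)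
  have hfreq : ∀ a, Tendsto (fun n : ℕ => (zeroCount (Real.ofDigits (d a)) n : ℝ) / n) atTop
      (𝓝 (T (Real.ofDigits (d a)))) := by
    intro a
    obtain ⟨hy, hlow, hupp⟩ := hball _ (hclose a)
    simp only [zeroCount_ofDigits (hzeros a)]
    refine tendsto_frequency_of_greedy (hT _ hy.2) hlow hupp (fun j hj => ?_) (hone a) (hgreedy a)
    rw [← (hWmem (a (j - m₀))).2, ← Finset.inter_eq_right.2 (hWmem (a (j - m₀))).1,
      ← Finset.filter_mem_eq_inter, Finset.card_filter, Nat.cast_sum]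
    refine Finset.sum_congr rfl fun s hs => ?_
    rw [hfree a j hj s (Finset.mem_range.1 hs)]
    split_ifs <;> simp
  have hsep : ∀ a a' : ℕ → Fin b, ∀ j, (∀ i < j, a i = a' i) → a j ≠ a' j →
      ((2 : ℝ) ^ ((m₀ + j + 1) * P))⁻¹ ≤ |Real.ofDigits (d a) - Real.ofDigits (d a')| := by
    intro a a' j _ hne
    obtain ⟨s, hs, hds⟩ : ∃ s < L, d a ((m₀ + j) * P + s) ≠ d a' ((m₀ + j) * P + s) := by
      by_contra! hcon
      refine hne (hWinj (Finset.ext fun s => ?_))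
      by_cases hs : s < L
      · have := hcon s hs
        rw [hfree a _ (by omega) s hs, hfree a' _ (by omega) s hs, Nat.add_sub_cancel_left] at this
        constructor <;> intro h <;> by_contra hn
        · rw [if_pos h, if_neg hn] at this
          exact absurd this (by decide)
        · rw [if_pos h, if_neg hn] at this
          exact absurd this (by decide)
      · exact iff_of_false (fun h => hs (Finset.mem_range.1 ((hWmem _).1 h)))
          (fun h => hs (Finset.mem_range.1 ((hWmem _).1 h)))
    have := inv_two_pow_le_abs_ofDigits_sub (show (m₀ + j) * P + s < (m₀ + j) * P + (L + M) by omega)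
      hds (hone a _ (by omega)) (hone a' _ (by omega))
    convert this using 3
    rw [hP]
    ring
  have hbpow : ∀ j : ℕ, ((b : ℝ) ^ j)⁻¹ ≤
      ((2 : NNReal) ^ (((m₀ + 1 : ℕ) : ℝ) * P * D) : NNReal) *
        (((2 : ℝ) ^ ((m₀ + j + 1) * P))⁻¹) ^ (D : ℝ) := by
    intro j
    have hbp : (0 : ℝ) < b := by exact_mod_cast hpos
    have h2 : (((2 : ℝ) ^ ((m₀ + j + 1) * P))⁻¹) ^ (D : ℝ) =
        (2 : ℝ) ^ (-(((m₀ + j + 1) * P : ℕ) : ℝ) * D) := by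
      rw [← Real.rpow_natCast, ← Real.rpow_neg two_pos.le, ← Real.rpow_mul two_pos.le]
    rw [h2, NNReal.coe_rpow, NNReal.coe_ofNat, ← Real.rpow_add two_pos,
      ← Real.log_le_log_iff (by positivity) (by positivity), Real.log_inv, Real.log_pow,
      Real.log_rpow two_pos]
    have : (0 : ℝ) ≤ j := by positivity
    push_cast
    nlinarith
  have h := le_dimH_range_of_separated hb1 (g := fun a => Real.ofDigits (d a)) hD
    fun a a' j h1 h2 => (hbpow j).trans (mul_le_mul_of_nonneg_left
      (Real.rpow_le_rpow (by positivity) (hsep a a' j h1 h2) hDpos.le) (NNReal.coe_nonneg _))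
  refine h.trans (dimH_mono ?_)
  rintro _ ⟨a, rfl⟩
  exact ⟨(hball _ (hclose a)).1, hfreq a⟩

/-! ### Counting zeros -/

lemma zeroCount_eq_digitCount (y : ℝ) (n : ℕ) : zeroCount y n = digitCount 0 y n := by
  rw [zeroCount, digitCount, Finset.card_filter, Finset.card_filter,
    Fin.sum_univ_eq_sum_range (fun i => if binDigit y (i + 1) = 0 then 1 else 0),
    Finset.range_eq_Ico, Finset.sum_Ico_add' (fun i => if binDigit y i = 0 then 1 else 0)]
  rfl

lemma zeroCount_add_digitCount_one (y : ℝ) (n : ℕ) : zeroCount y n + digitCount 1 y n = n := by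
  have h : (Finset.univ.filter fun i : Fin n => binDigit y (i + 1) = 1) =
      Finset.univ.filter fun i : Fin n => ¬ binDigit y (i + 1) = 0 := by
    refine Finset.filter_congr fun i _ => ?_
    rcases binDigit_succ_eq_zero_or_one y i with h | h <;> simp [h]
  rw [zeroCount_eq_digitCount, digitCount, digitCount, h,
    Finset.card_filter_add_card_filter_not, Finset.card_univ, Fintype.card_fin]

lemma zeroCount_div_mem_Icc (y : ℝ) (n : ℕ) : (zeroCount y n : ℝ) / n ∈ Icc (0 : ℝ) 1 := by
  have h : zeroCount y n ≤ n := by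
    have := zeroCount_add_digitCount_one y n
    omega
  exact ⟨by positivity, div_le_one_of_le₀ (by exact_mod_cast h) (by positivity)⟩

/-! ### Lower limits of asymptotically affine sequences -/

section LowerLimit

variable {u f : ℕ → ℝ} {A B : ℝ}

lemma isBoundedUnder_of_tendsto_sub_affine (hB : 0 < B) (hf : ∀ n, f n ∈ Icc (0 : ℝ) 1)
    (hu : Tendsto (fun n => u n - (A + B * f n)) atTop (𝓝 0)) :
    IsBoundedUnder (· ≤ ·) atTop u ∧ IsBoundedUnder (· ≥ ·) atTop u := by
  have h := hu.eventually (Ioo_mem_nhds (show (-1 : ℝ) < 0 by norm_num) one_pos)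
  refine ⟨⟨A + B + 1, ?_⟩, ⟨A - 1, ?_⟩⟩ <;> rw [eventually_map] <;>
    filter_upwards [h] with n hn
  · nlinarith [hn.2, (hf n).2]
  · simp only [ge_iff_le]
    nlinarith [hn.1, (hf n).1]

lemma frequently_lt_of_liminf_lt (hB : 0 < B) (hf : ∀ n, f n ∈ Icc (0 : ℝ) 1)
    (hu : Tendsto (fun n => u n - (A + B * f n)) atTop (𝓝 0)) {s : ℝ}
    (hs : (liminf u atTop - A) / B < s) : ∃ᶠ n in atTop, f n < s := by
  rw [div_lt_iff₀ hB] at hs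
  by_contra hcon
  rw [not_frequently] at hcon
  set ε := (s * B - (liminf u atTop - A)) / 2 with hε
  have hε0 : 0 < ε := by linarith
  have h := hu.eventually (lt_mem_nhds (show -ε < 0 by linarith))
  have : A + B * s - ε ≤ liminf u atTop := by
    refine le_liminf_of_le
      (isBoundedUnder_of_tendsto_sub_affine hB hf hu).1.isCoboundedUnder_ge ?_
    filter_upwards [h, hcon] with n h1 h2
    nlinarith [mul_le_mul_of_nonneg_left (not_lt.1 h2) hB.le]
  linarith

lemma eventually_lt_of_lt_liminf_affine (hB : 0 < B) (hf : ∀ n, f n ∈ Icc (0 : ℝ) 1)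
    (hu : Tendsto (fun n => u n - (A + B * f n)) atTop (𝓝 0)) {s : ℝ}
    (hs : s < (liminf u atTop - A) / B) : ∀ᶠ n in atTop, s < f n := by
  rw [lt_div_iff₀ hB] at hs
  set ε := (liminf u atTop - A - s * B) / 2 with hε
  have hε0 : 0 < ε := by linarith
  have h := hu.eventually (gt_mem_nhds (show 0 < ε by linarith))
  have h' := eventually_lt_of_lt_liminf (show A + s * B + ε < liminf u atTop by linarith)
    (isBoundedUnder_of_tendsto_sub_affine hB hf hu).2
  filter_upwards [h, h'] with n h1 h2
  have : s * B < f n * B := by linarith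
  exact lt_of_mul_lt_mul_right this hB.le

lemma liminf_eq_of_tendsto_affine {H : ℝ} (hB : 0 < B)
    (hu : Tendsto (fun n => u n - (A + B * f n)) atTop (𝓝 0))
    (hf : Tendsto f atTop (𝓝 ((H - A) / B))) : liminf u atTop = H := by
  refine Tendsto.liminf_eq ?_
  have := hu.add ((hf.const_mul B).const_add A)
  simpa [mul_div_cancel₀ _ hB.ne'] using this

end LowerLimit

/-! ### The exponent and the frequency of zeros -/

/-- The frequency of zeros at which the standard Bernoulli measure of parameter `p y` has
exponent `H`. -/
def expFrequency (p : ℝ → ℝ) (H y : ℝ) : ℝ :=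
  (H + Real.logb 2 (1 - p y)) / (Real.logb 2 (1 - p y) - Real.logb 2 (p y))

lemma logb_one_sub_sub_logb_pos {q : ℝ} (hq : q ∈ Ioo (0 : ℝ) (1 / 2)) :
    0 < Real.logb 2 (1 - q) - Real.logb 2 q :=
  sub_pos.2 (Real.logb_lt_logb one_lt_two hq.1 (by linarith [hq.2]))

lemma continuousAt_expFrequency {p : ℝ → ℝ} (hpc : ContinuousOn p (Icc 0 1))
    (hpr : ∀ t ∈ Icc (0 : ℝ) 1, p t ∈ Ioo (0 : ℝ) (1 / 2)) (H : ℝ) {y : ℝ}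
    (hy : y ∈ Ioo (0 : ℝ) 1) : ContinuousAt (expFrequency p H) y := by
  have hq := hpr y (Ioo_subset_Icc_self hy)
  have hp : ContinuousAt p y := hpc.continuousAt (Icc_mem_nhds hy.1 hy.2)
  have h1 : ContinuousAt (fun y => Real.logb 2 (1 - p y)) y :=
    (continuousAt_const.sub hp).logb (sub_pos.2 (hq.2.trans one_half_lt_one)).ne'
  have h2 : ContinuousAt (fun y => Real.logb 2 (p y)) y := hp.logb hq.1.ne'
  exact (continuousAt_const.add h1).div (h1.sub h2) (logb_one_sub_sub_logb_pos hq).ne'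

lemma frequently_zeroCount_lt {p : ℝ → ℝ} (hpc : ContinuousOn p (Icc 0 1))
    (hpr : ∀ t ∈ Icc (0 : ℝ) 1, p t ∈ Ioo (0 : ℝ) (1 / 2)) {y s : ℝ} (hy : y ∈ Ioo (0 : ℝ) 1)
    (hs : expFrequency p (bernExp p y) y < s) : ∃ᶠ n in atTop, (zeroCount y n : ℝ) / n < s := by
  refine frequently_lt_of_liminf_lt
    (logb_one_sub_sub_logb_pos (hpr y (Ioo_subset_Icc_self hy))) (zeroCount_div_mem_Icc y)
    (tendsto_logRatio_sub hpc hpr hy) ?_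
  rwa [sub_neg_eq_add]

lemma eventually_lt_zeroCount {p : ℝ → ℝ} (hpc : ContinuousOn p (Icc 0 1))
    (hpr : ∀ t ∈ Icc (0 : ℝ) 1, p t ∈ Ioo (0 : ℝ) (1 / 2)) {y s : ℝ} (hy : y ∈ Ioo (0 : ℝ) 1)
    (hs : s < expFrequency p (bernExp p y) y) : ∀ᶠ n in atTop, s < (zeroCount y n : ℝ) / n := by
  refine eventually_lt_of_lt_liminf_affine
    (logb_one_sub_sub_logb_pos (hpr y (Ioo_subset_Icc_self hy))) (zeroCount_div_mem_Icc y)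
    (tendsto_logRatio_sub hpc hpr hy) ?_
  rwa [sub_neg_eq_add]

lemma bernExp_eq_of_tendsto {p : ℝ → ℝ} (hpc : ContinuousOn p (Icc 0 1))
    (hpr : ∀ t ∈ Icc (0 : ℝ) 1, p t ∈ Ioo (0 : ℝ) (1 / 2)) {y H : ℝ} (hy : y ∈ Ioo (0 : ℝ) 1)
    (h : Tendsto (fun n : ℕ => (zeroCount y n : ℝ) / n) atTop (𝓝 (expFrequency p H y))) :
    bernExp p y = H := by
  refine liminf_eq_of_tendsto_affine
    (logb_one_sub_sub_logb_pos (hpr y (Ioo_subset_Icc_self hy)))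
    (tendsto_logRatio_sub hpc hpr hy) ?_
  rwa [sub_neg_eq_add]

lemma expFrequency_bernExp_mem_Icc {p : ℝ → ℝ} (hpc : ContinuousOn p (Icc 0 1))
    (hpr : ∀ t ∈ Icc (0 : ℝ) 1, p t ∈ Ioo (0 : ℝ) (1 / 2)) {y : ℝ} (hy : y ∈ Ioo (0 : ℝ) 1) :
    expFrequency p (bernExp p y) y ∈ Icc (0 : ℝ) 1 := by
  constructor
  · by_contra! h
    obtain ⟨n, hn⟩ := (frequently_zeroCount_lt hpc hpr hy h).exists
    exact hn.not_ge (zeroCount_div_mem_Icc y n).1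
  · by_contra! h
    obtain ⟨n, hn⟩ := (eventually_lt_zeroCount hpc hpr hy h).exists
    exact hn.not_ge (zeroCount_div_mem_Icc y n).2

lemma dimH_bernExp_eq_le {p : ℝ → ℝ} (hpc : ContinuousOn p (Icc 0 1))
    (hpr : ∀ t ∈ Icc (0 : ℝ) 1, p t ∈ Ioo (0 : ℝ) (1 / 2)) {H s : ℝ} (hs0 : 0 < s)
    (hs : s ≤ 1 / 2) {d : NNReal} (hd : Real.binEntropy s < d * Real.log 2) {U : Set ℝ}
    (hU : (∀ y ∈ U, expFrequency p H y < s) ∨ ∀ y ∈ U, 1 - s < expFrequency p H y) :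
    dimH {y ∈ U ∩ Ioo (0 : ℝ) 1 | bernExp p y = H} ≤ d := by
  rcases hU with hU | hU
  · refine (dimH_mono ?_).trans (dimH_frequently_digitCount_le (Or.inl rfl) hs0 hs hd)
    rintro y ⟨⟨hyU, hy⟩, rfl⟩
    refine ⟨Ioo_subset_Ico_self hy, ((frequently_zeroCount_lt hpc hpr hy (hU y hyU)).and_eventually
      (eventually_gt_atTop 0)).mono fun n hn => ?_⟩
    have hn0 : (0 : ℝ) < n := by exact_mod_cast hn.2
    rw [← zeroCount_eq_digitCount]
    exact ((div_lt_iff₀ hn0).1 hn.1).le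
  · refine (dimH_mono ?_).trans (dimH_frequently_digitCount_le (Or.inr rfl) hs0 hs hd)
    rintro y ⟨⟨hyU, hy⟩, rfl⟩
    refine ⟨Ioo_subset_Ico_self hy, ((eventually_lt_zeroCount hpc hpr hy (hU y hyU)).and
      (eventually_gt_atTop 0)).frequently.mono fun n hn => ?_⟩
    have hn0 : (0 : ℝ) < n := by exact_mod_cast hn.2
    have h1 := (lt_div_iff₀ hn0).1 hn.1
    have h2 : (zeroCount y n : ℝ) + digitCount 1 y n = n := by
      exact_mod_cast zeroCount_add_digitCount_one y n
    linarith

lemma exists_gt_binEntropy_lt {t c : ℝ} (ht : t < 1 / 2) (hc : Real.binEntropy t < c) :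
    ∃ s, t < s ∧ s ≤ 1 / 2 ∧ Real.binEntropy s < c := by
  have h := (Real.binEntropy_continuous.tendsto t).eventually (gt_mem_nhds hc)
  obtain ⟨s, ⟨h1, h2⟩, h3⟩ := (Filter.Eventually.and (Ioo_mem_nhdsGT ht)
    (h.filter_mono nhdsWithin_le_nhds)).exists
  exact ⟨s, h1, h2.le, h3⟩

lemma exists_pos_forall_Ioo {q : ℝ → Prop} {x : ℝ} (h : ∀ᶠ y in 𝓝 x, q y) :
    ∃ r > 0, ∀ y ∈ Ioo (x - r) (x + r), q y := by
  obtain ⟨r, hr, h⟩ := Metric.eventually_nhds_iff_ball.1 h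
  exact ⟨r, hr, by rwa [← Real.ball_eq_Ioo]⟩

lemma bernLocSpectrum_le {p : ℝ → ℝ} (hpc : ContinuousOn p (Icc 0 1))
    (hpr : ∀ t ∈ Icc (0 : ℝ) 1, p t ∈ Ioo (0 : ℝ) (1 / 2)) {x H : ℝ} (hx : x ∈ Ioo (0 : ℝ) 1)
    (ht : expFrequency p H x ∈ Icc (0 : ℝ) 1) {d : NNReal}
    (hd : Real.binEntropy (expFrequency p H x) < d * Real.log 2) :
    bernLocSpectrum p x H ≤ d := by
  have hcont := continuousAt_expFrequency hpc hpr H hx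
  obtain h | h | h := lt_trichotomy (expFrequency p H x) (1 / 2)
  · obtain ⟨s, hts, hs, hsd⟩ := exists_gt_binEntropy_lt h hd
    obtain ⟨r, hr, hU⟩ := exists_pos_forall_Ioo (hcont.eventually (gt_mem_nhds hts))
    exact iInf₂_le_of_le r hr
      (dimH_bernExp_eq_le hpc hpr (ht.1.trans_lt hts) hs hsd (Or.inl hU))
  · have hd1 : (1 : ℝ) < d := by
      rw [h, one_div, Real.binEntropy_two_inv] at hd
      have := Real.log_pos one_lt_two
      nlinarith
    refine iInf₂_le_of_le 1 one_pos ((dimH_mono (subset_univ _)).trans ?_)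
    rw [Real.dimH_univ]
    exact_mod_cast hd1.le
  · rw [← Real.binEntropy_one_sub] at hd
    obtain ⟨s, hts, hs, hsd⟩ := exists_gt_binEntropy_lt (by linarith) hd
    obtain ⟨r, hr, hU⟩ := exists_pos_forall_Ioo
      (hcont.eventually (lt_mem_nhds (show 1 - s < _ by linarith)))
    exact iInf₂_le_of_le r hr
      (dimH_bernExp_eq_le hpc hpr (by linarith [ht.2]) hs hsd (Or.inr hU))

lemma le_bernLocSpectrum {p : ℝ → ℝ} (hpc : ContinuousOn p (Icc 0 1))
    (hpr : ∀ t ∈ Icc (0 : ℝ) 1, p t ∈ Ioo (0 : ℝ) (1 / 2)) {x H : ℝ} (hx : x ∈ Ioo (0 : ℝ) 1)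
    (ht : expFrequency p H x ∈ Icc (0 : ℝ) 1) {d : NNReal}
    (hd : d * Real.log 2 < Real.binEntropy (expFrequency p H x)) :
    d ≤ bernLocSpectrum p x H := by
  rcases eq_zero_or_pos d with rfl | hd0
  · simp
  have ht' : expFrequency p H x ∈ Ioo (0 : ℝ) 1 := by
    have h0 : 0 < Real.binEntropy (expFrequency p H x) :=
      lt_of_le_of_lt (mul_nonneg d.coe_nonneg (Real.log_pos one_lt_two).le) hd
    refine ⟨ht.1.lt_of_ne fun h => ?_, ht.2.lt_of_ne fun h => ?_⟩
    · simp [← h] at h0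
    · simp [h] at h0
  refine le_iInf₂ fun r hr => ?_
  refine (le_dimH_frequency (fun y hy => continuousAt_expFrequency hpc hpr H hy) hx ht' hd0 hd
    hr).trans (dimH_mono ?_)
  rintro y ⟨hy, hlim⟩
  exact ⟨hy, bernExp_eq_of_tendsto hpc hpr hy.2 hlim⟩

/-- Let `x ∈ (0,1)` and `q = p(x)`.
(i) For `H ∈ [−log₂(1−q), −log₂ q]`, the local multifractal spectrum of the
localized Bernoulli measure equals the spectrum of the standard Bernoulli measure of
parameter `q`: `d(x,H) = −t log₂ t − (1−t) log₂(1−t)` where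
`t = (H + log₂(1−q))/(log₂(1−q) − log₂ q)` (with the convention `0·log₂ 0 = 0`,
which is automatic since `Real.logb 2 0 = 0`).
(ii) For `H ≥ 0` with `H > −log₂ q` or `H < −log₂(1−q)`, there is `r > 0` with
`{y ∈ (x−r,x+r) ∩ (0,1) : h^d(y) = H} = ∅`. -/
theorem bernLocSpectrum_eq (p : ℝ → ℝ)
    (hpc : ContinuousOn p (Set.Icc 0 1))
    (hpr : ∀ t ∈ Set.Icc (0 : ℝ) 1, p t ∈ Set.Ioo (0 : ℝ) (1 / 2))
    (x : ℝ) (hx : x ∈ Set.Ioo (0 : ℝ) 1) :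
    (∀ H ∈ Set.Icc (-Real.logb 2 (1 - p x)) (-Real.logb 2 (p x)),
        ∀ t : ℝ,
          t = (H + Real.logb 2 (1 - p x)) / (Real.logb 2 (1 - p x) - Real.logb 2 (p x)) →
          bernLocSpectrum p x H
            = ENNReal.ofReal (-t * Real.logb 2 t - (1 - t) * Real.logb 2 (1 - t))) ∧
      (∀ H : ℝ, 0 ≤ H →
        (H > -Real.logb 2 (p x) ∨ H < -Real.logb 2 (1 - p x)) →
        ∃ r : ℝ, 0 < r ∧
          {y ∈ Set.Ioo (x - r) (x + r) ∩ Set.Ioo (0 : ℝ) 1 | bernExp p y = H} = ∅) := by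
  have hB := logb_one_sub_sub_logb_pos (hpr x (Ioo_subset_Icc_self hx))
  refine ⟨?_, ?_⟩
  · rintro H ⟨hH1, hH2⟩ t ht
    replace ht : t = expFrequency p H x := ht
    have hlog2 := Real.log_pos one_lt_two
    have htI : expFrequency p H x ∈ Icc (0 : ℝ) 1 :=
      ⟨div_nonneg (by linarith) hB.le, (div_le_one hB).2 (by linarith)⟩
    have hent : -t * Real.logb 2 t - (1 - t) * Real.logb 2 (1 - t) =
        Real.binEntropy t / Real.log 2 := by
      rw [Real.binEntropy_eq_negMulLog_add_negMulLog_one_sub, Real.negMulLog, Real.negMulLog,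
        Real.logb, Real.logb]
      ring
    rw [hent, ht]
    refine le_antisymm (le_of_forall_gt_imp_ge_of_dense fun e he => ?_)
      (le_of_forall_lt_imp_le_of_dense fun e he => ?_)
    · obtain ⟨d, hd1, hd2⟩ := ENNReal.lt_iff_exists_nnreal_btwn.1 he
      refine (bernLocSpectrum_le hpc hpr hx htI ?_).trans hd2.le
      rw [ENNReal.ofReal_lt_coe_iff
        (div_nonneg (Real.binEntropy_nonneg htI.1 htI.2) hlog2.le)] at hd1
      exact (div_lt_iff₀ hlog2).1 hd1
    · lift e to NNReal using he.ne_top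
      refine le_bernLocSpectrum hpc hpr hx htI ?_
      rw [← ENNReal.ofReal_coe_nnreal] at he
      exact (lt_div_iff₀ hlog2).1 (ENNReal.ofReal_lt_ofReal_iff'.1 he).1
  · intro H _ hH
    have hcont := continuousAt_expFrequency hpc hpr H hx
    have hev : ∀ᶠ y in 𝓝 x, expFrequency p H y ∉ Icc (0 : ℝ) 1 := by
      refine hcont.eventually (isClosed_Icc.isOpen_compl.mem_nhds fun h => ?_)
      have h1 := (le_div_iff₀ hB).1 h.1
      have h2 := (div_le_one hB).1 h.2
      rcases hH with hH | hH <;> linarith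
    obtain ⟨r, hr, hU⟩ := exists_pos_forall_Ioo hev
    refine ⟨r, hr, eq_empty_of_forall_notMem ?_⟩
    rintro y ⟨⟨hy, hy01⟩, rfl⟩
    exact hU y hy (expFrequency_bernExp_mem_Icc hpc hpr hy01)

end
end

section
/- For every x ∈ (0,1) and every p ∈ ℝ, the local scaling function of the dyadic family E built from the Birkhoff sums of φ satisfies τ_E(x,p) = (θ(x)·p − P(−γ(x)·p)) / log 2. -/
open MeasureTheory Filter Metric Set
open scoped ENNReal Topology

noncomputable section

/-- The dyadic interval of scale `j` and index `k`: `[k 2^{-j}, (k+1) 2^{-j})`. -/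
def dyadicInt (j : ℕ) (k : ℤ) : Set ℝ :=
  Set.Ico ((k : ℝ) * 2 ^ (-(j : ℤ))) (((k : ℝ) + 1) * 2 ^ (-(j : ℤ)))

/-- The closure of the dyadic interval of scale `j` and index `k`. -/
def dyadicIntCl (j : ℕ) (k : ℤ) : Set ℝ :=
  Set.Icc ((k : ℝ) * 2 ^ (-(j : ℤ))) (((k : ℝ) + 1) * 2 ^ (-(j : ℤ)))

/-- The index of the unique dyadic interval of scale `j` containing `x`. -/
def dyadicIntIdx (j : ℕ) (x : ℝ) : ℤ := ⌊x * 2 ^ (j : ℕ)⌋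

/-- The `j`-th Birkhoff sum of `φ` for the doubling map:
`S_jφ(x) = Σ_{k=0}^{j−1} φ(2^k x)`. -/
def birkSum (φ : ℝ → ℝ) (j : ℕ) (x : ℝ) : ℝ :=
  ∑ k ∈ Finset.range j, φ (2 ^ k * x)

/-- `e_λ = sup_{x ∈ closure(λ)} exp(−γ(x) S_jφ(x) − j θ(x))` for a dyadic interval
`λ` of scale `j`. -/
def birkE (φ γ θ : ℝ → ℝ) (j : ℕ) (k : ℤ) : ℝ :=
  sSup ((fun x => Real.exp (-(γ x * birkSum φ j x) - j * θ x)) '' dyadicIntCl j k)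

/-- The lower exponent `h_E(x) = liminf_{j→∞} log e_{λ_j(x)} / log 2^{-j}` of the
dyadic family `(e_λ)`, in `[-∞,∞]` with the convention `log 0 = -∞`. -/
def birkExp (φ γ θ : ℝ → ℝ) (x : ℝ) : EReal :=
  Filter.liminf
    (fun j : ℕ =>
      if birkE φ γ θ j (dyadicIntIdx j x) = 0 then (⊤ : EReal)
      else ((Real.log (birkE φ γ θ j (dyadicIntIdx j x)) /
          Real.log ((2 : ℝ) ^ (-(j : ℤ))) : ℝ) : EReal))
    Filter.atTop

/-- The structure function `S_j(ω,p) = Σ_{λ ⊆ ω, ⟨λ⟩ = j} (e_λ)^p`. -/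
def birkStructFn (φ γ θ : ℝ → ℝ) (ω : Set ℝ) (j : ℕ) (p : ℝ) : ℝ :=
  ∑ᶠ k ∈ {k : ℤ | dyadicInt j k ⊆ ω}, birkE φ γ θ j k ^ p

/-- The scaling function `τ_E^ω(p) = liminf_{j→∞} log S_j(ω,p) / log 2^{-j}`. -/
def birkScalingFn (φ γ θ : ℝ → ℝ) (ω : Set ℝ) (p : ℝ) : ℝ :=
  Filter.liminf
    (fun j : ℕ => Real.log (birkStructFn φ γ θ ω j p) / Real.log ((2 : ℝ) ^ (-(j : ℤ))))
    Filter.atTop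

/-- The local scaling function `τ_E(x,p) = lim_{r→0⁺} τ_E^{B(x,r)∩(0,1)}(p)`; by
monotonicity in `r` it equals the supremum over `r > 0`. -/
def birkLocScalingFn (φ γ θ : ℝ → ℝ) (x : ℝ) (p : ℝ) : ℝ :=
  ⨆ r : {r : ℝ // 0 < r},
    birkScalingFn φ γ θ (Metric.ball x r.1 ∩ Set.Ioo (0 : ℝ) 1) p

/-- The partition sum appearing in the definition of the pressure:
`Σ_{λ ⊆ (0,1), ⟨λ⟩ = j} sup_{x ∈ closure(λ)} e^{q S_jφ(x)}`. -/
def pressureSum (φ : ℝ → ℝ) (q : ℝ) (j : ℕ) : ℝ :=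
  ∑ᶠ k ∈ {k : ℤ | dyadicInt j k ⊆ Set.Ioo (0 : ℝ) 1},
    sSup ((fun x => Real.exp (q * birkSum φ j x)) '' dyadicIntCl j k)

section Doubling

variable {φ : ℝ → ℝ}

lemma Function.Periodic.uniformContinuous_of_continuous_real
    (hper : Function.Periodic φ 1) (hc : Continuous φ) : UniformContinuous φ := by
  have huc : UniformContinuousOn φ (Icc (-1) 2) :=
    isCompact_Icc.uniformContinuousOn_of_continuous hc.continuousOn
  rw [Metric.uniformContinuousOn_iff] at huc
  rw [Metric.uniformContinuous_iff]
  intro ε hε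
  obtain ⟨δ, hδ, h⟩ := huc ε hε
  refine ⟨min δ 1, by positivity, fun {a b} hab => ?_⟩
  have hab' : dist a b < δ := hab.trans_le (min_le_left _ _)
  have hab1 : dist a b < 1 := hab.trans_le (min_le_right _ _)
  have h1 := Int.floor_le a
  have h2 := Int.lt_floor_add_one a
  rw [Real.dist_eq, abs_lt] at hab1
  have key := h (a - ⌊a⌋) ⟨by linarith, by linarith⟩ (b - ⌊a⌋) ⟨by linarith, by linarith⟩
    (by simpa using hab')
  have e (t : ℝ) : φ (t - ⌊a⌋) = φ t := by simpa using hper.sub_zsmul_eq (x := t) ⌊a⌋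
  rwa [e, e] at key

lemma abs_birkSum_le {M : ℝ} (hM : ∀ t, |φ t| ≤ M) (j : ℕ) (y : ℝ) :
    |birkSum φ j y| ≤ j * M := by
  unfold birkSum
  refine (Finset.abs_sum_le_sum_abs _ _).trans ?_
  simpa using Finset.sum_le_sum fun k (_ : k ∈ Finset.range j) => hM (2 ^ k * y)

lemma birkSum_add (φ : ℝ → ℝ) (n i : ℕ) (y : ℝ) :
    birkSum φ (n + i) y = birkSum φ n y + birkSum φ i (2 ^ n * y) := by
  simp only [birkSum, Finset.sum_range_add]
  congr 1
  refine Finset.sum_congr rfl fun k _ => ?_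
  ring_nf

lemma birkSum_int_add (hper : Function.Periodic φ 1) (i : ℕ) (m : ℤ) (y : ℝ) :
    birkSum φ i (m + y) = birkSum φ i y := by
  unfold birkSum
  refine Finset.sum_congr rfl fun k _ => ?_
  have := hper.int_mul (2 ^ k * m) (2 ^ k * y)
  rw [← this]
  push_cast
  ring_nf

/-- The Birkhoff sums of a continuous periodic function oscillate by `o(j)` on dyadic intervals of
scale `j`. -/
lemma eventually_abs_birkSum_sub_le (hper : Function.Periodic φ 1) (hc : Continuous φ)
    {M : ℝ} (hM : ∀ t, |φ t| ≤ M) {ε : ℝ} (hε : 0 < ε) :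
    ∀ᶠ j : ℕ in atTop, ∀ k : ℤ, ∀ y ∈ dyadicIntCl j k, ∀ z ∈ dyadicIntCl j k,
      |birkSum φ j y - birkSum φ j z| ≤ j * ε := by
  obtain ⟨δ, hδ, hδ'⟩ := Metric.uniformContinuous_iff.1
    (hper.uniformContinuous_of_continuous_real hc) (ε / 2) (by positivity)
  obtain ⟨N, hN⟩ := exists_pow_lt_of_lt_one hδ (by norm_num : (1 / 2 : ℝ) < 1)
  have hlarge : ∀ᶠ j : ℕ in atTop, N * (2 * M) / (ε / 2) ≤ j :=
    tendsto_natCast_atTop_atTop.eventually_ge_atTop _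
  filter_upwards [hlarge, eventually_ge_atTop N] with j hj hjN k y hy z hz
  rw [div_le_iff₀ (by positivity)] at hj
  obtain ⟨i, rfl⟩ := Nat.exists_eq_add_of_le' hjN
  have hyz : |y - z| ≤ (1 / 2) ^ (i + N) := by
    obtain ⟨h1, h2⟩ := hy
    obtain ⟨h3, h4⟩ := hz
    have e : (2 : ℝ) ^ (-((i + N : ℕ) : ℤ)) = (1 / 2) ^ (i + N) := by
      rw [zpow_neg, zpow_natCast]; simp
    rw [e] at h1 h2 h3 h4
    rw [abs_le]
    constructor <;> linarith
  have hhead : |birkSum φ i y - birkSum φ i z| ≤ i * (ε / 2) := by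
    unfold birkSum
    rw [← Finset.sum_sub_distrib]
    refine (Finset.abs_sum_le_sum_abs _ _).trans ?_
    have : ∀ l ∈ Finset.range i, |φ (2 ^ l * y) - φ (2 ^ l * z)| ≤ ε / 2 := fun l hl => by
      rw [← Real.dist_eq]
      refine (hδ' ?_).le
      rw [Real.dist_eq, ← mul_sub, abs_mul, abs_of_pos (by positivity)]
      refine lt_of_le_of_lt ?_ hN
      have hl' : l ≤ i := (Finset.mem_range.1 hl).le
      calc (2 : ℝ) ^ l * |y - z| ≤ 2 ^ i * (1 / 2) ^ (i + N) := by
            gcongr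
            norm_num
        _ = (1 / 2) ^ N := by
            rw [pow_add, ← mul_assoc, ← mul_pow]; norm_num
    simpa using Finset.sum_le_sum this
  have htail : |birkSum φ N (2 ^ i * y) - birkSum φ N (2 ^ i * z)| ≤ N * (2 * M) := by
    refine (abs_sub _ _).trans ?_
    linarith [abs_birkSum_le hM N (2 ^ i * y), abs_birkSum_le hM N (2 ^ i * z)]
  rw [birkSum_add, birkSum_add]
  calc _ = |(birkSum φ i y - birkSum φ i z)
          + (birkSum φ N (2 ^ i * y) - birkSum φ N (2 ^ i * z))| := by ring_nf
    _ ≤ i * (ε / 2) + N * (2 * M) := (abs_add_le _ _).trans (add_le_add hhead htail)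
    _ ≤ _ := by
        push_cast at hj ⊢
        nlinarith [Nat.cast_nonneg (α := ℝ) N]

end Doubling

lemma sSup_exp_image_bounds {s : Set ℝ} (hs : s.Nonempty) {f : ℝ → ℝ} {c D : ℝ}
    (h : ∀ y ∈ s, |f y - c| ≤ D) :
    0 < sSup ((fun y => Real.exp (f y)) '' s) ∧
      |Real.log (sSup ((fun y => Real.exp (f y)) '' s)) - c| ≤ D := by
  obtain ⟨y, hy⟩ := hs
  have hub : ∀ z ∈ (fun y => Real.exp (f y)) '' s, z ≤ Real.exp (c + D) := by
    rintro _ ⟨z, hz, rfl⟩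
    exact Real.exp_le_exp.2 (by linarith [(abs_le.1 (h z hz)).2])
  have hle : sSup ((fun y => Real.exp (f y)) '' s) ≤ Real.exp (c + D) :=
    csSup_le ⟨_, y, hy, rfl⟩ hub
  have hge : Real.exp (c - D) ≤ sSup ((fun y => Real.exp (f y)) '' s) :=
    (Real.exp_le_exp.2 (by linarith [(abs_le.1 (h y hy)).1])).trans
      (le_csSup ⟨_, hub⟩ ⟨y, hy, rfl⟩)
  have hpos := (Real.exp_pos _).trans_le hge
  refine ⟨hpos, abs_le.2 ⟨?_, ?_⟩⟩
  · linarith [(Real.le_log_iff_exp_le hpos).2 hge]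
  · linarith [(Real.log_le_iff_le_exp hpos).2 hle]

/-- The supremum of `e^{q S_jφ}` over the closed dyadic interval of scale `j` and index `k`. -/
def dyadicWeight (φ : ℝ → ℝ) (q : ℝ) (j : ℕ) (k : ℤ) : ℝ :=
  sSup ((fun x => Real.exp (q * birkSum φ j x)) '' dyadicIntCl j k)

lemma left_mem_dyadicIntCl (j : ℕ) (k : ℤ) : (k : ℝ) * 2 ^ (-(j : ℤ)) ∈ dyadicIntCl j k := by
  refine ⟨le_rfl, ?_⟩
  gcongr
  linarith

lemma dyadicIntCl_eq_closure (j : ℕ) (k : ℤ) : dyadicIntCl j k = closure (dyadicInt j k) := by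
  unfold dyadicIntCl dyadicInt
  rw [closure_Ico]
  refine ne_of_lt ?_
  gcongr
  linarith

lemma mem_dyadicInt_iff {j : ℕ} {k : ℤ} {y : ℝ} :
    y ∈ dyadicInt j k ↔ (k : ℝ) ≤ y * 2 ^ j ∧ y * 2 ^ j < k + 1 := by
  simp only [dyadicInt, mem_Ico, zpow_neg, zpow_natCast, ← div_eq_mul_inv]
  rw [div_le_iff₀ (by positivity), lt_div_iff₀ (by positivity)]

lemma mem_dyadicIntCl_iff {j : ℕ} {k : ℤ} {y : ℝ} :
    y ∈ dyadicIntCl j k ↔ (k : ℝ) ≤ y * 2 ^ j ∧ y * 2 ^ j ≤ k + 1 := by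
  simp only [dyadicIntCl, mem_Icc, zpow_neg, zpow_natCast, ← div_eq_mul_inv]
  rw [div_le_iff₀ (by positivity), le_div_iff₀ (by positivity)]

lemma bddAbove_image_exp_birkSum {φ : ℝ → ℝ} {M : ℝ} (hM : ∀ t, |φ t| ≤ M) (q : ℝ) (j : ℕ)
    (s : Set ℝ) : BddAbove ((fun x => Real.exp (q * birkSum φ j x)) '' s) := by
  refine ⟨Real.exp (|q| * (j * M)), ?_⟩
  rintro _ ⟨y, -, rfl⟩
  refine Real.exp_le_exp.2 ((le_abs_self _).trans ?_)
  rw [abs_mul]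
  exact mul_le_mul_of_nonneg_left (abs_birkSum_le hM j y) (abs_nonneg q)

lemma dyadicWeight_pos {φ : ℝ → ℝ} {M : ℝ} (hM : ∀ t, |φ t| ≤ M) (q : ℝ) (j : ℕ) (k : ℤ) :
    0 < dyadicWeight φ q j k :=
  (Real.exp_pos _).trans_le (le_csSup (bddAbove_image_exp_birkSum hM q j _)
    ⟨_, left_mem_dyadicIntCl j k, rfl⟩)

/-- On dyadic intervals where `γ` and `θ` are `η`-close to their values at `x`, the weight `e_λ ^ p`
is comparable to `e^{-jθ(x)p} sup_λ e^{-γ(x)p S_jφ}`. -/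
lemma eventually_birkE_rpow_bounds {φ γ θ : ℝ → ℝ} (hper : Function.Periodic φ 1)
    (hc : Continuous φ) {M : ℝ} (hM : ∀ t, |φ t| ≤ M) (x p η : ℝ) {ε : ℝ} (hε : 0 < ε) :
    ∀ᶠ j : ℕ in atTop, ∀ k : ℤ,
      (∀ y ∈ dyadicIntCl j k, |γ y - γ x| ≤ η ∧ |θ y - θ x| ≤ η) →
      Real.exp (-(j * (θ x * p + (|p| * ((M + 1) * η) + ε)))) * dyadicWeight φ (-(γ x) * p) j k
          ≤ birkE φ γ θ j k ^ p ∧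
        birkE φ γ θ j k ^ p ≤
          Real.exp (-(j * (θ x * p - (|p| * ((M + 1) * η) + ε))))
            * dyadicWeight φ (-(γ x) * p) j k := by
  set B := 2 * (|p| * |γ x|) + 1 with hB
  have hBpos : 0 < B := by positivity
  filter_upwards [eventually_abs_birkSum_sub_le hper hc hM (div_pos hε hBpos)] with j hj k hk
  set y₀ := (k : ℝ) * 2 ^ (-(j : ℤ))
  have hy₀ : y₀ ∈ dyadicIntCl j k := left_mem_dyadicIntCl j k
  have hη : 0 ≤ η := (abs_nonneg _).trans (hk y₀ hy₀).1
  have hj0 : (0 : ℝ) ≤ j := j.cast_nonneg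
  obtain ⟨hepos, helog⟩ := sSup_exp_image_bounds ⟨y₀, hy₀⟩
    (f := fun y => -(γ y * birkSum φ j y) - j * θ y)
    (c := -(γ x * birkSum φ j y₀) - j * θ x)
    (D := η * (j * M) + |γ x| * (j * (ε / B)) + j * η) (fun y hy => by
      have h1 : |(γ y - γ x) * birkSum φ j y| ≤ η * (j * M) := by
        rw [abs_mul]
        exact mul_le_mul (hk y hy).1 (abs_birkSum_le hM j y) (abs_nonneg _) hη
      have h2 : |γ x * (birkSum φ j y - birkSum φ j y₀)| ≤ |γ x| * (j * (ε / B)) := by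
        rw [abs_mul]
        exact mul_le_mul_of_nonneg_left (hj k y hy y₀ hy₀) (abs_nonneg _)
      have h3 : |j * (θ y - θ x)| ≤ j * η := by
        rw [abs_mul, abs_of_nonneg hj0]
        exact mul_le_mul_of_nonneg_left (hk y hy).2 hj0
      rw [abs_le] at h1 h2 h3 ⊢
      constructor <;> linarith)
  obtain ⟨hapos, halog⟩ := sSup_exp_image_bounds ⟨y₀, hy₀⟩
    (f := fun y => (-(γ x) * p) * birkSum φ j y)
    (c := (-(γ x) * p) * birkSum φ j y₀)
    (D := (|γ x| * |p|) * (j * (ε / B))) (fun y hy => by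
      rw [← mul_sub, abs_mul, abs_mul, abs_neg]
      exact mul_le_mul_of_nonneg_left (hj k y hy y₀ hy₀) (by positivity))
  change 0 < birkE φ γ θ j k at hepos
  change |Real.log (birkE φ γ θ j k) - _| ≤ _ at helog
  change 0 < dyadicWeight φ (-(γ x) * p) j k at hapos
  change |Real.log (dyadicWeight φ (-(γ x) * p) j k) - _| ≤ _ at halog
  have hplog := mul_le_mul_of_nonneg_left helog (abs_nonneg p)
  rw [← abs_mul, mul_sub] at hplog
  have hεB : B * (j * (ε / B)) = j * ε := by field_simp
  have hsmall : 2 * (|p| * |γ x|) * (j * (ε / B)) ≤ j * ε := by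
    rw [← hεB]
    exact mul_le_mul_of_nonneg_right (by linarith) (by positivity)
  rw [Real.rpow_def_of_pos hepos]
  rw [← Real.exp_log hapos, ← Real.exp_add, ← Real.exp_add, Real.exp_le_exp, Real.exp_le_exp]
  rw [abs_le] at hplog halog
  constructor <;> nlinarith

lemma finite_setOf_dyadicInt_subset (j : ℕ) :
    {k : ℤ | dyadicInt j k ⊆ Ioo (0 : ℝ) 1}.Finite := by
  refine (Set.finite_Icc (0 : ℤ) (2 ^ j)).subset fun k hk => ?_
  have hmem : (k : ℝ) / 2 ^ j ∈ dyadicInt j k := by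
    rw [mem_dyadicInt_iff, div_mul_cancel₀ _ (by positivity)]
    constructor <;> linarith
  obtain ⟨h1, h2⟩ := hk hmem
  rw [div_lt_one (by positivity)] at h2
  have h1' : (0 : ℝ) < k := by
    by_contra! h
    exact absurd h1 (not_lt.2 (div_nonpos_of_nonpos_of_nonneg h (by positivity)))
  exact ⟨by exact_mod_cast h1'.le, by exact_mod_cast h2.le⟩

lemma pressureSum_pos {φ : ℝ → ℝ} {M : ℝ} (hM : ∀ t, |φ t| ≤ M) (q : ℝ) {j : ℕ} (hj : 1 ≤ j) :
    0 < pressureSum φ q j := by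
  have hone : (1 : ℤ) ∈ {k : ℤ | dyadicInt j k ⊆ Ioo (0 : ℝ) 1} := by
    intro y hy
    rw [mem_dyadicInt_iff] at hy
    obtain ⟨h1, h2⟩ := hy
    have hpow : (2 : ℝ) ≤ 2 ^ j := by
      simpa using pow_le_pow_right₀ (by norm_num : (1 : ℝ) ≤ 2) hj
    push_cast at h1 h2
    constructor <;> by_contra! h <;> nlinarith
  unfold pressureSum
  rw [finsum_mem_eq_finite_toFinset_sum _ (finite_setOf_dyadicInt_subset j)]
  exact Finset.sum_pos (fun k _ => dyadicWeight_pos hM q j k) ⟨1, by simpa using hone⟩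

lemma dyadicWeight_le_of_shift {φ : ℝ → ℝ} (hper : Function.Periodic φ 1) {M : ℝ}
    (hM : ∀ t, |φ t| ≤ M) (q : ℝ) (n i : ℕ) (m k : ℤ) :
    Real.exp (-(|q| * (n * M))) * dyadicWeight φ q i k
      ≤ dyadicWeight φ q (n + i) (m * 2 ^ i + k) := by
  rw [Real.exp_neg, inv_mul_le_iff₀ (Real.exp_pos _)]
  refine csSup_le ⟨_, _, left_mem_dyadicIntCl i k, rfl⟩ ?_
  rintro _ ⟨y, hy, rfl⟩
  have hmem : (m + y) / 2 ^ n ∈ dyadicIntCl (n + i) (m * 2 ^ i + k) := by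
    rw [mem_dyadicIntCl_iff] at hy ⊢
    have : (m + y) / 2 ^ n * 2 ^ (n + i) = m * 2 ^ i + y * 2 ^ i := by
      rw [pow_add]; field_simp
    rw [this]
    push_cast
    constructor <;> linarith
  refine le_trans ?_ (mul_le_mul_of_nonneg_left (le_csSup (bddAbove_image_exp_birkSum hM q _ _)
    ⟨_, hmem, rfl⟩) (Real.exp_pos _).le)
  simp only
  rw [← Real.exp_add, Real.exp_le_exp, birkSum_add, mul_div_cancel₀ _ (by positivity),
    birkSum_int_add hper, mul_add]
  have h : |q * birkSum φ n ((m + y) / 2 ^ n)| ≤ |q| * (n * M) := by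
    rw [abs_mul]
    exact mul_le_mul_of_nonneg_left (abs_birkSum_le hM n _) (abs_nonneg q)
  linarith [(abs_le.1 h).1]

lemma dyadicInt_shift_subset {n i : ℕ} {m k : ℤ} (hk : dyadicInt i k ⊆ Ioo (0 : ℝ) 1) :
    dyadicInt (n + i) (m * 2 ^ i + k) ⊆ dyadicInt n m := by
  intro y hy
  have hmem : y * 2 ^ n - m ∈ dyadicInt i k := by
    rw [mem_dyadicInt_iff] at hy ⊢
    rw [pow_add] at hy
    push_cast at hy
    constructor <;> linarith
  have := hk hmem
  rw [mem_dyadicInt_iff]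
  constructor <;> linarith [this.1, this.2]

lemma exists_dyadicInt_subset {x : ℝ} {ω : Set ℝ} (hω : ω ∈ 𝓝 x) :
    ∃ (n : ℕ) (m : ℤ), dyadicInt n m ⊆ ω := by
  obtain ⟨δ, hδ, hball⟩ := Metric.mem_nhds_iff.1 hω
  obtain ⟨n, hn⟩ := exists_pow_lt_of_lt_one hδ (by norm_num : (1 / 2 : ℝ) < 1)
  refine ⟨n, ⌊x * 2 ^ n⌋, fun y hy => hball ?_⟩
  rw [mem_dyadicInt_iff] at hy
  have h1 := Int.floor_le (x * 2 ^ n)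
  have h2 := Int.lt_floor_add_one (x * 2 ^ n)
  rw [Metric.mem_ball, Real.dist_eq]
  refine lt_of_le_of_lt ?_ hn
  have : |(y - x) * 2 ^ n| ≤ 1 := by
    rw [abs_le]
    constructor <;> linarith [hy.1, hy.2]
  rw [abs_mul, abs_of_pos (by positivity : (0 : ℝ) < 2 ^ n)] at this
  rw [div_pow, one_pow, le_div_iff₀ (by positivity)]
  exact this

lemma birkStructFn_le {φ γ θ : ℝ → ℝ} {M : ℝ} (hM : ∀ t, |φ t| ≤ M) {ω : Set ℝ}
    (hω : ω ⊆ Ioo 0 1) {j : ℕ} {p q c : ℝ}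
    (h : ∀ k, dyadicInt j k ⊆ ω → birkE φ γ θ j k ^ p ≤ Real.exp c * dyadicWeight φ q j k) :
    birkStructFn φ γ θ ω j p ≤ Real.exp c * pressureSum φ q j := by
  have hfin := finite_setOf_dyadicInt_subset j
  have hsub : {k : ℤ | dyadicInt j k ⊆ ω} ⊆ {k : ℤ | dyadicInt j k ⊆ Ioo (0 : ℝ) 1} :=
    fun k hk => subset_trans hk hω
  unfold birkStructFn pressureSum
  rw [finsum_mem_eq_finite_toFinset_sum _ hfin,
    finsum_mem_eq_finite_toFinset_sum _ (hfin.subset hsub), Finset.mul_sum]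
  refine (Finset.sum_le_sum fun k hk => h k (by simpa using hk)).trans ?_
  refine Finset.sum_le_sum_of_subset_of_nonneg (by simpa using hsub) fun k _ _ => ?_
  exact mul_nonneg (Real.exp_pos _).le (dyadicWeight_pos hM q j k).le

lemma le_birkStructFn {φ γ θ : ℝ → ℝ} (hper : Function.Periodic φ 1) {M : ℝ}
    (hM : ∀ t, |φ t| ≤ M) {ω : Set ℝ} (hω : ω ⊆ Ioo 0 1) {n i : ℕ} {m : ℤ}
    (hm : dyadicInt n m ⊆ ω) {p q c : ℝ}
    (h : ∀ k, dyadicInt (n + i) k ⊆ ω →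
      Real.exp c * dyadicWeight φ q (n + i) k ≤ birkE φ γ θ (n + i) k ^ p) :
    Real.exp (c - |q| * (n * M)) * pressureSum φ q i ≤ birkStructFn φ γ θ ω (n + i) p := by
  have hfin := finite_setOf_dyadicInt_subset i
  have hfin' := (finite_setOf_dyadicInt_subset (n + i)).subset
    fun k (hk : dyadicInt (n + i) k ⊆ ω) => subset_trans hk hω
  unfold birkStructFn pressureSum
  rw [finsum_mem_eq_finite_toFinset_sum _ hfin, Finset.mul_sum,
    finsum_mem_eq_finite_toFinset_sum (s := {k : ℤ | dyadicInt (n + i) k ⊆ ω}) _ hfin']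
  have hinj : Set.InjOn (fun k : ℤ => m * 2 ^ i + k) (hfin.toFinset : Set ℤ) :=
    (add_right_injective _).injOn
  calc _ ≤ ∑ k ∈ hfin.toFinset, birkE φ γ θ (n + i) (m * 2 ^ i + k) ^ p := by
        refine Finset.sum_le_sum fun k hk => ?_
        refine le_trans ?_ (h _ ((dyadicInt_shift_subset (by simpa using hk)).trans hm))
        rw [sub_eq_add_neg, Real.exp_add, mul_assoc]
        exact mul_le_mul_of_nonneg_left (dyadicWeight_le_of_shift hper hM q n i m k)
          (Real.exp_pos _).le
    _ = ∑ k ∈ hfin.toFinset.image (fun k : ℤ => m * 2 ^ i + k), birkE φ γ θ (n + i) k ^ p :=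
        (Finset.sum_image (f := fun k => birkE φ γ θ (n + i) k ^ p) hinj).symm
    _ ≤ _ := by
        refine Finset.sum_le_sum_of_subset_of_nonneg ?_ fun k hk _ => ?_
        · intro k hk
          obtain ⟨l, hl, rfl⟩ := Finset.mem_image.1 hk
          exact hfin'.mem_toFinset.2
            ((dyadicInt_shift_subset (hfin.mem_toFinset.1 hl)).trans hm)
        · exact (mul_nonneg (Real.exp_pos _).le (dyadicWeight_pos hM q _ k).le).trans
            (h k (hfin'.mem_toFinset.1 hk))

/-- Two-sided bound on the quotients defining the scaling function of a neighbourhood of `x` on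
which `γ` and `θ` are `η`-close to their values at `x`. -/
lemma eventually_birkScaling_bounds {φ γ θ : ℝ → ℝ} (hper : Function.Periodic φ 1)
    (hc : Continuous φ) {M : ℝ} (hM : ∀ t, |φ t| ≤ M) {x p η P : ℝ}
    (hP : Tendsto (fun j : ℕ => (1 / (j : ℝ)) * Real.log (pressureSum φ (-(γ x) * p) j))
      atTop (𝓝 P))
    {ω : Set ℝ} (hω : ω ⊆ Ioo 0 1) (hωx : ω ∈ 𝓝 x)
    (hη : ∀ y ∈ closure ω, |γ y - γ x| ≤ η ∧ |θ y - θ x| ≤ η) {ε : ℝ} (hε : 0 < ε) :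
    ∀ᶠ j : ℕ in atTop, 0 < birkStructFn φ γ θ ω j p ∧
      (θ x * p - P - (|p| * ((M + 1) * η) + ε)) / Real.log 2 ≤
          Real.log (birkStructFn φ γ θ ω j p) / Real.log ((2 : ℝ) ^ (-(j : ℤ))) ∧
        Real.log (birkStructFn φ γ θ ω j p) / Real.log ((2 : ℝ) ^ (-(j : ℤ))) ≤
          (θ x * p - P + (|p| * ((M + 1) * η) + ε)) / Real.log 2 := by
  set q := -(γ x) * p with hq
  obtain ⟨n, m, hnm⟩ := exists_dyadicInt_subset hωx
  have hcl (j : ℕ) (k : ℤ) (hk : dyadicInt j k ⊆ ω) :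
      ∀ y ∈ dyadicIntCl j k, |γ y - γ x| ≤ η ∧ |θ y - θ x| ≤ η := fun y hy =>
    hη y (closure_mono hk (by rwa [← dyadicIntCl_eq_closure]))
  have hshift : Tendsto (fun i : ℕ => Real.log (pressureSum φ q i) / ((n + i : ℕ) : ℝ))
      atTop (𝓝 P) := by
    have hratio : Tendsto (fun i : ℕ => (i : ℝ) / (i + n)) atTop (𝓝 1) :=
      tendsto_natCast_div_add_atTop (n : ℝ)
    have := hP.mul hratio
    rw [mul_one] at this
    refine this.congr' ?_
    filter_upwards [eventually_ge_atTop 1] with i hi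
    have : (0 : ℝ) < i := by exact_mod_cast hi
    push_cast
    field_simp
    ring
  have hconst : Tendsto (fun i : ℕ => |q| * (n * M) / ((n + i : ℕ) : ℝ)) atTop (𝓝 0) :=
    tendsto_const_nhds.div_atTop
      (tendsto_natCast_atTop_atTop.comp (tendsto_atTop_mono (fun i => Nat.le_add_left i n)
        tendsto_id))
  have hmap : Tendsto (fun i : ℕ => n + i) atTop atTop :=
    tendsto_atTop_mono (fun i => Nat.le_add_left i n) tendsto_id
  have hε2 : 0 < ε / 2 := by positivity
  have hε4 : 0 < ε / 4 := by positivity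
  have hbd := eventually_birkE_rpow_bounds (γ := γ) (θ := θ) hper hc hM x p η hε2
  suffices h : ∀ᶠ i : ℕ in atTop, 0 < birkStructFn φ γ θ ω (n + i) p ∧
      (θ x * p - P - (|p| * ((M + 1) * η) + ε)) / Real.log 2 ≤
          Real.log (birkStructFn φ γ θ ω (n + i) p) / Real.log ((2 : ℝ) ^ (-((n + i : ℕ) : ℤ))) ∧
        Real.log (birkStructFn φ γ θ ω (n + i) p) / Real.log ((2 : ℝ) ^ (-((n + i : ℕ) : ℤ))) ≤
          (θ x * p - P + (|p| * ((M + 1) * η) + ε)) / Real.log 2 by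
    obtain ⟨N, hN⟩ := eventually_atTop.1 h
    filter_upwards [eventually_ge_atTop (n + N)] with j hj
    obtain ⟨i, rfl⟩ := Nat.exists_eq_add_of_le ((Nat.le_add_right n N).trans hj)
    exact hN i (by omega)
  filter_upwards [hmap.eventually hbd, hmap.eventually (hP.eventually (gt_mem_nhds
    (show P < P + ε / 2 by linarith))), hshift.eventually (lt_mem_nhds
    (show P - ε / 4 < P by linarith)), hconst.eventually (gt_mem_nhds hε4),
    eventually_ge_atTop 1] with i hb hup hlow hcst hi
  have hup' := birkStructFn_le (θ := θ) (p := p) hM hω fun k hk => (hb k (hcl _ k hk)).2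
  have hlow' := le_birkStructFn (θ := θ) (p := p) hper hM hω hnm
    fun k hk => (hb k (hcl _ k hk)).1
  have hPi := pressureSum_pos hM q hi
  have hPni := pressureSum_pos hM q (hi.trans (Nat.le_add_left i n))
  have hSpos := (mul_pos (Real.exp_pos _) hPi).trans_le hlow'
  have hlogup := Real.log_le_log hSpos hup'
  have hloglow := Real.log_le_log (mul_pos (Real.exp_pos _) hPi) hlow'
  rw [Real.log_mul (Real.exp_pos _).ne' hPni.ne', Real.log_exp] at hlogup
  rw [Real.log_mul (Real.exp_pos _).ne' hPi.ne', Real.log_exp] at hloglow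
  set j := n + i
  have hj0 : (0 : ℝ) < j := by exact_mod_cast (hi.trans (Nat.le_add_left i n))
  have hl2 : 0 < Real.log 2 := Real.log_pos (by norm_num)
  rw [one_div, inv_mul_lt_iff₀ hj0] at hup
  rw [lt_div_iff₀ hj0] at hlow
  rw [div_lt_iff₀ hj0] at hcst
  set L := Real.log (birkStructFn φ γ θ ω j p)
  have hden : L / Real.log ((2 : ℝ) ^ (-(j : ℤ))) = -(L / j) / Real.log 2 := by
    rw [Real.log_zpow]
    push_cast
    field_simp
  rw [hden]
  refine ⟨hSpos, ?_, ?_⟩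
  · refine div_le_div_of_nonneg_right ?_ hl2.le
    rw [le_neg, div_le_iff₀ hj0]
    linarith
  · refine div_le_div_of_nonneg_right ?_ hl2.le
    rw [neg_le, le_div_iff₀ hj0]
    linarith

lemma birkStructFn_mono {φ γ θ : ℝ → ℝ} {ω ω' : Set ℝ} (hsub : ω' ⊆ ω) (hω : ω ⊆ Ioo 0 1)
    (j : ℕ) (p : ℝ) : birkStructFn φ γ θ ω' j p ≤ birkStructFn φ γ θ ω j p := by
  have hfin := (finite_setOf_dyadicInt_subset j).subset
    fun k (hk : dyadicInt j k ⊆ ω) => subset_trans hk hω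
  have hsub' : {k : ℤ | dyadicInt j k ⊆ ω'} ⊆ {k : ℤ | dyadicInt j k ⊆ ω} :=
    fun k hk => subset_trans hk hsub
  unfold birkStructFn
  rw [finsum_mem_eq_finite_toFinset_sum (s := {k : ℤ | dyadicInt j k ⊆ ω}) _ hfin,
    finsum_mem_eq_finite_toFinset_sum _ (hfin.subset hsub')]
  refine Finset.sum_le_sum_of_subset_of_nonneg (Set.Finite.toFinset_mono hsub') fun k _ _ => ?_
  refine Real.rpow_nonneg (Real.sSup_nonneg ?_) p
  rintro _ ⟨y, -, rfl⟩
  exact (Real.exp_pos _).le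

/-- Shrinking the region can only increase the quotients defining the scaling function. -/
lemma birkScaling_quotient_anti {φ γ θ : ℝ → ℝ} {ω ω' : Set ℝ} {j : ℕ} {p : ℝ}
    (hpos : 0 < birkStructFn φ γ θ ω' j p) (hsub : ω' ⊆ ω) (hω : ω ⊆ Ioo 0 1) :
    Real.log (birkStructFn φ γ θ ω j p) / Real.log ((2 : ℝ) ^ (-(j : ℤ))) ≤
      Real.log (birkStructFn φ γ θ ω' j p) / Real.log ((2 : ℝ) ^ (-(j : ℤ))) := by
  refine div_le_div_of_nonpos_of_le ?_ (Real.log_le_log hpos (birkStructFn_mono hsub hω j p))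
  rw [Real.log_zpow]
  push_cast
  nlinarith [Real.log_nonneg (by norm_num : (1 : ℝ) ≤ 2), Nat.cast_nonneg (α := ℝ) j]

/-- For every `x ∈ (0,1)` and every `p ∈ ℝ`, the local scaling function of the
dyadic family built from the Birkhoff sums of `φ` satisfies
`τ_E(x,p) = (θ(x)p − P(−γ(x)p)) / log 2`. -/
theorem birkLocScalingFn_eq (φ γ θ : ℝ → ℝ)
    (hφc : Continuous φ) (hφper : ∀ x : ℝ, φ (x + 1) = φ x)
    (hγc : ContinuousOn γ (Set.Icc 0 1))
    (hγpos : ∀ t ∈ Set.Icc (0 : ℝ) 1, 0 < γ t)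
    (hθc : ContinuousOn θ (Set.Icc 0 1))
    (Pr : ℝ → ℝ)
    (hPr : ∀ q : ℝ, Filter.Tendsto
      (fun j : ℕ => (1 / (j : ℝ)) * Real.log (pressureSum φ q j))
      Filter.atTop (nhds (Pr q))) :
    ∀ x ∈ Set.Ioo (0 : ℝ) 1, ∀ p : ℝ,
      birkLocScalingFn φ γ θ x p = (θ x * p - Pr (-(γ x) * p)) / Real.log 2 := by
  intro x hx p
  have hper : Function.Periodic φ 1 := hφper
  obtain ⟨M, hM'⟩ := (hper.isBounded_of_continuous one_ne_zero hφc).exists_norm_le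
  have hM : ∀ t, |φ t| ≤ M := fun t => hM' _ ⟨t, rfl⟩
  have hM0 : 0 ≤ M := (abs_nonneg _).trans (hM 0)
  have hl2 : 0 < Real.log 2 := Real.log_pos (by norm_num)
  have hP := hPr (-(γ x) * p)
  set P := Pr (-(γ x) * p)
  set ω : ℝ → Set ℝ := fun r => Metric.ball x r ∩ Ioo 0 1 with hω
  set f : ℝ → ℕ → ℝ := fun r j =>
    Real.log (birkStructFn φ γ θ (ω r) j p) / Real.log ((2 : ℝ) ^ (-(j : ℤ))) with hf
  set L := (θ x * p - P) / Real.log 2 with hL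
  have hω01 (r : ℝ) : ω r ⊆ Ioo 0 1 := inter_subset_right
  have hωx {r : ℝ} (hr : 0 < r) : ω r ∈ 𝓝 x :=
    inter_mem (Metric.ball_mem_nhds x hr) (Ioo_mem_nhds hx.1 hx.2)
  have hωcl (r : ℝ) : closure (ω r) ⊆ Metric.closedBall x r ∩ Icc 0 1 :=
    closure_minimal (inter_subset_inter Metric.ball_subset_closedBall Ioo_subset_Icc_self)
      (Metric.isClosed_closedBall.inter isClosed_Icc)
  have hnear {δ : ℝ} (hδ : 0 < δ) : ∃ r₀ > 0, ∀ r, 0 < r → r ≤ r₀ → ∀ᶠ j in atTop,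
      0 < birkStructFn φ γ θ (ω r) j p ∧ L - δ ≤ f r j ∧ f r j ≤ L + δ := by
    set κ := δ * Real.log 2 with hκ
    have hκpos : 0 < κ := by positivity
    set η := κ / (2 * (|p| * (M + 1) + 1)) with hηdef
    have hη : 0 < η := by positivity
    have hηle : |p| * ((M + 1) * η) + κ / 2 ≤ κ := by
      have h : (|p| * (M + 1) + 1) * η = κ / 2 := by
        rw [hηdef]
        field_simp
      linarith
    have hxI : x ∈ Icc (0 : ℝ) 1 := Ioo_subset_Icc_self hx
    obtain ⟨r₁, hr₁, h₁⟩ := Metric.continuousWithinAt_iff.1 (hγc x hxI) η hη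
    obtain ⟨r₂, hr₂, h₂⟩ := Metric.continuousWithinAt_iff.1 (hθc x hxI) η hη
    refine ⟨min r₁ r₂ / 2, by positivity, fun r hr hrle => ?_⟩
    have hclose : ∀ y ∈ closure (ω r), |γ y - γ x| ≤ η ∧ |θ y - θ x| ≤ η := fun y hy => by
      obtain ⟨hy1, hy2⟩ := hωcl r hy
      have hd : dist y x < min r₁ r₂ := by
        have : 0 < min r₁ r₂ := by positivity
        have := Metric.mem_closedBall.1 hy1
        linarith
      exact ⟨(h₁ hy2 (hd.trans_le (min_le_left _ _))).le,
        (h₂ hy2 (hd.trans_le (min_le_right _ _))).le⟩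
    filter_upwards [eventually_birkScaling_bounds hper hφc hM hP (hω01 r) (hωx hr) hclose
      (half_pos hκpos)] with j hj
    refine ⟨hj.1, le_trans ?_ hj.2.1, hj.2.2.trans ?_⟩
    · rw [hL, le_div_iff₀ hl2, sub_mul, div_mul_cancel₀ _ hl2.ne']
      linarith
    · rw [hL, div_le_iff₀ hl2, add_mul _ δ, div_mul_cancel₀ _ hl2.ne']
      linarith
  have hbelow {r : ℝ} (hr : 0 < r) : IsBoundedUnder (· ≥ ·) atTop (f r) := by
    obtain ⟨A, hA⟩ := isCompact_Icc.exists_bound_of_continuousOn (hγc.sub continuousOn_const)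
      (f := fun y => γ y - γ x)
    obtain ⟨A', hA'⟩ := isCompact_Icc.exists_bound_of_continuousOn (hθc.sub continuousOn_const)
      (f := fun y => θ y - θ x)
    have hbd := eventually_birkScaling_bounds hper hφc hM hP (hω01 r) (hωx hr)
      (η := max A A') (fun y hy => ⟨(hA y (hωcl r hy).2).trans (le_max_left _ _),
        (hA' y (hωcl r hy).2).trans (le_max_right _ _)⟩) one_pos
    exact ⟨_, eventually_map.2 (hbd.mono fun j hj => hj.2.1)⟩
  have habove {r δ : ℝ} (hr : 0 < r) (hδ : 0 < δ) : ∀ᶠ j in atTop, f r j ≤ L + δ := by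
    obtain ⟨r₀, hr₀, h⟩ := hnear hδ
    filter_upwards [h (min r r₀) (lt_min hr hr₀) (min_le_right _ _)] with j hj
    exact (birkScaling_quotient_anti hj.1 (inter_subset_inter_left _
      (Metric.ball_subset_ball (min_le_left r r₀))) (hω01 r)).trans hj.2.2
  have hle (r : {r : ℝ // 0 < r}) : birkScalingFn φ γ θ (ω r.1) p ≤ L :=
    le_of_forall_pos_le_add fun δ hδ =>
      liminf_le_of_frequently_le (habove r.2 hδ).frequently (hbelow r.2)
  have : Nonempty {r : ℝ // 0 < r} := ⟨⟨1, one_pos⟩⟩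
  refine le_antisymm (ciSup_le hle) (le_of_forall_pos_le_add fun δ hδ => ?_)
  obtain ⟨r₀, hr₀, h⟩ := hnear hδ
  have hcob : IsCoboundedUnder (· ≥ ·) atTop (f r₀) :=
    IsBoundedUnder.isCoboundedUnder_ge ⟨L + 1, eventually_map.2 (habove hr₀ one_pos)⟩
  have hge : L - δ ≤ birkScalingFn φ γ θ (ω r₀) p :=
    le_liminf_of_le hcob ((h r₀ hr₀ le_rfl).mono fun j hj => hj.2.1)
  have hsup : birkScalingFn φ γ θ (ω r₀) p ≤ birkLocScalingFn φ γ θ x p :=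
    le_ciSup (f := fun r : {r : ℝ // 0 < r} => birkScalingFn φ γ θ (ω r.1) p)
      ⟨L, by rintro _ ⟨r, rfl⟩; exact hle r⟩ ⟨r₀, hr₀⟩
  linarith

end
end
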